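/- arXiv:1310.7834 — 2 statements merged into one kernel-verified Lean document; each statement's English description precedes it below -/
import Mathlib

section
/- For every matroid median instance and every fractional solution (x,y), there exists an integral solution whose cost is at most 8 times the cost of (x,y). In particular, the natural LP relaxation of the matroid median problem has integrality gap at most 8. -/
open scoped Classical
open Finset

/-- The rank function of a matroid: the maximum cardinality of an independent
subset of the given set. -/
noncomputable def matroidRank {α : Type*} (M : Matroid α) (S : Finset α) : ℕ :=
  (S.powerset.filter (fun I : Finset α => M.Indep ↑I)).sup Finset.card

theorem kernel_exists {F : Type*} [Fintype F] (C : Finset (Finset F))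
    (h : C.card < Fintype.card F) :
    ∃ δ : F → ℝ, δ ≠ 0 ∧ ∀ S ∈ C, ∑ i ∈ S, δ i = 0 := by
  let L : (F → ℝ) →ₗ[ℝ] (C → ℝ) :=
    LinearMap.pi (fun S : C => ∑ i ∈ S.1, LinearMap.proj i)
  have hk : LinearMap.ker L ≠ ⊥ := by
    apply LinearMap.ker_ne_bot_of_finrank_lt
    simpa using h
  obtain ⟨δ, hδ, hne⟩ := (Submodule.ne_bot_iff _).1 hk
  refine ⟨δ, hne, fun S hS => ?_⟩
  have := congrFun (LinearMap.mem_ker.1 hδ) ⟨S, hS⟩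
  simpa [L] using this

theorem two_card_le {F : Type*} [Fintype F] (E : Finset F) (A : Finset (Finset F))
    (hA : ∀ S ∈ A, S ⊆ E ∧ 2 ≤ S.card) (hAd : ∀ S ∈ A, ∀ T ∈ A, S ≠ T → Disjoint S T) :
    2 * A.card ≤ (A.biUnion (fun S => S)).card ∧ A.biUnion (fun S => S) ⊆ E := by
  constructor
  · rw [Finset.card_biUnion (fun S hS T hT hne => hAd S hS T hT hne), mul_comm]
    exact Finset.card_nsmul_le_sum A _ 2 (fun S hS => (hA S hS).2)
  · exact Finset.biUnion_subset.2 (fun S hS => (hA S hS).1)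

theorem two_families {F : Type*} [Fintype F] (E : Finset F) (hE : E.Nonempty)
    (A B : Finset (Finset F))
    (hA : ∀ S ∈ A, S ⊆ E ∧ 2 ≤ S.card) (hAd : ∀ S ∈ A, ∀ T ∈ A, S ≠ T → Disjoint S T)
    (hB : ∀ S ∈ B, S ⊆ E ∧ 2 ≤ S.card) (hBd : ∀ S ∈ B, ∀ T ∈ B, S ≠ T → Disjoint S T) :
    ∃ δ : F → ℝ, δ ≠ 0 ∧ (∀ i, i ∉ E → δ i = 0) ∧ (∀ S ∈ A, ∑ i ∈ S, δ i = 0) ∧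
      ∀ S ∈ B, ∑ i ∈ S, δ i = 0 := by
  obtain ⟨hA1, hA2⟩ := two_card_le E A hA hAd
  obtain ⟨hB1, hB2⟩ := two_card_le E B hB hBd
  have hEpos : 0 < E.card := hE.card_pos
  have hEc : Eᶜ.card + E.card = Fintype.card F := by
    rw [add_comm]; exact Finset.card_add_card_compl E
  have key : ∀ A' : Finset (Finset F), A'.card + B.card < E.card →
      ∃ δ : F → ℝ, δ ≠ 0 ∧ (∀ i, i ∉ E → δ i = 0) ∧ (∀ S ∈ A', ∑ i ∈ S, δ i = 0) ∧
      ∀ S ∈ B, ∑ i ∈ S, δ i = 0 := by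
    intro A' hlt
    obtain ⟨δ, h0, h⟩ := kernel_exists ((Eᶜ.image (fun i => ({i} : Finset F))) ∪ (A' ∪ B)) (by
      have h1 := Finset.card_union_le (Eᶜ.image (fun i => ({i} : Finset F))) (A' ∪ B)
      have h2 := Finset.card_union_le A' B
      have h3 : (Eᶜ.image (fun i => ({i} : Finset F))).card ≤ Eᶜ.card := Finset.card_image_le
      omega)
    refine ⟨δ, h0, ?_, ?_, ?_⟩
    · intro i hi
      have := h {i} (by simp [hi])
      simpa using this
    · intro S hS; exact h S (by simp [hS])
    · intro S hS; exact h S (by simp [hS])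
  have hAle := Finset.card_le_card hA2
  have hBle := Finset.card_le_card hB2
  by_cases hlt : A.card + B.card < E.card
  · exact key A hlt
  have hAE : A.biUnion (fun S => S) = E := Finset.eq_of_subset_of_card_le hA2 (by omega)
  have hBE : B.biUnion (fun S => S) = E := Finset.eq_of_subset_of_card_le hB2 (by omega)
  have hApos : 0 < A.card := by omega
  obtain ⟨S0, hS0⟩ := Finset.card_pos.1 hApos
  obtain ⟨δ, h0, h1, h2, h3⟩ := key (A.erase S0) (by
    rw [Finset.card_erase_of_mem hS0]; omega)
  refine ⟨δ, h0, h1, ?_, h3⟩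
  have hsumB : ∑ i ∈ E, δ i = 0 := by
    rw [← hBE, Finset.sum_biUnion (fun S hS T hT hne => hBd S hS T hT hne)]
    exact Finset.sum_eq_zero h3
  have hsumA : ∑ i ∈ E, δ i = ∑ i ∈ S0, δ i := by
    rw [← hAE, Finset.sum_biUnion (fun S hS T hT hne => hAd S hS T hT hne),
      ← Finset.add_sum_erase _ _ hS0, Finset.sum_eq_zero (s := A.erase S0) h2]
    simp
  intro S hS
  by_cases hSS : S = S0
  · rw [hSS, ← hsumA, hsumB]
  · exact h2 S (Finset.mem_erase.2 ⟨hSS, hS⟩)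

/-- A real number that is an integer. -/
def IsIntR (a : ℝ) : Prop := ∃ n : ℤ, (n : ℝ) = a

theorem isIntR_sum {F : Type*} (S : Finset F) (w : F → ℝ) (h : ∀ i ∈ S, IsIntR (w i)) :
    IsIntR (∑ i ∈ S, w i) := by
  choose! g hg using h
  exact ⟨∑ i ∈ S, g i, by push_cast; exact Finset.sum_congr rfl hg⟩

theorem two_le_frac {F : Type*} [Fintype F] (w : F → ℝ) (S : Finset F)
    (hS : IsIntR (∑ i ∈ S, w i)) (i : F) (hi : i ∈ S) (hfi : ¬ IsIntR (w i)) :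
    2 ≤ (S.filter (fun i => ¬ IsIntR (w i))).card := by
  by_contra hlt
  have hmem : i ∈ S.filter (fun i => ¬ IsIntR (w i)) := by simp [hi, hfi]
  have hpos := Finset.card_pos.2 ⟨i, hmem⟩
  obtain ⟨a, ha⟩ := Finset.card_eq_one.1 (by omega : (S.filter (fun i => ¬ IsIntR (w i))).card = 1)
  have hia : i = a := by rw [ha] at hmem; simpa using hmem
  subst hia
  have hrest : IsIntR (∑ k ∈ S.erase i, w k) := by
    apply isIntR_sum
    intro k hk
    rw [Finset.mem_erase] at hk
    by_contra hkf
    have : k ∈ S.filter (fun i => ¬ IsIntR (w i)) := by simp [hk.2, hkf]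
    rw [ha] at this
    exact hk.1 (by simpa using this)
  obtain ⟨m, hm⟩ := hS
  obtain ⟨n, hn⟩ := hrest
  rw [← Finset.add_sum_erase _ _ hi] at hm
  exact hfi ⟨m - n, by push_cast; linarith⟩

/-- The direction lemma: if `w` has a fractional coordinate, there is a nonzero direction that
keeps all tight constraints. -/
theorem direction_exists {F J : Type*} [Fintype F] [Fintype J]
    (ρ : Finset F → ℤ) (h0 : ρ ∅ = 0)
    (hsub : ∀ S T, ρ (S ∪ T) + ρ (S ∩ T) ≤ ρ S + ρ T)
    (G : J → Finset F) (hG : ∀ j k, j ≠ k → Disjoint (G j) (G k))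
    (w : F → ℝ) (hw : ∀ S, ∑ i ∈ S, w i ≤ (ρ S : ℝ))
    (i0 : F) (hi0 : ¬ IsIntR (w i0)) :
    ∃ δ : F → ℝ, δ ≠ 0 ∧ (∀ i, IsIntR (w i) → δ i = 0) ∧
      (∀ S, ∑ i ∈ S, w i = (ρ S : ℝ) → ∑ i ∈ S, δ i = 0) ∧
      (∀ j, IsIntR (∑ i ∈ G j, w i) → ∑ i ∈ G j, δ i = 0) := by
  set tight : Finset F → Prop := fun S => ∑ i ∈ S, w i = (ρ S : ℝ) with htight
  have hboth : ∀ S T, tight S → tight T → tight (S ∪ T) ∧ tight (S ∩ T) := by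
    intro S T hS hT
    have e := Finset.sum_union_inter (s₁ := S) (s₂ := T) (f := w)
    have h1 := hw (S ∪ T)
    have h2 := hw (S ∩ T)
    have h3 : ((ρ (S ∪ T) + ρ (S ∩ T) : ℤ) : ℝ) ≤ ((ρ S + ρ T : ℤ) : ℝ) := by
      exact_mod_cast hsub S T
    push_cast at h3
    simp only [htight] at hS hT ⊢
    constructor <;> linarith
  have hmin : ∀ i, (∃ S, tight S ∧ i ∈ S) →
      ∃ T, tight T ∧ i ∈ T ∧ ∀ S, tight S → i ∈ S → T ⊆ S := by
    rintro i ⟨S, hS, hiS⟩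
    obtain ⟨T, hT, hTm⟩ := Finset.exists_min_image
      (Finset.univ.filter (fun S => tight S ∧ i ∈ S)) Finset.card ⟨S, by simp [hS, hiS]⟩
    simp only [Finset.mem_filter, Finset.mem_univ, true_and] at hT hTm
    refine ⟨T, hT.1, hT.2, fun S' hS' hi' => ?_⟩
    have := hTm (T ∩ S') ⟨(hboth T S' hT.1 hS').2, by simp [hT.2, hi']⟩
    have := Finset.eq_of_subset_of_card_le (Finset.inter_subset_left (s₁ := T) (s₂ := S')) this
    exact Finset.inter_eq_left.1 this
  choose! T hT1 hT2 hT3 using hmin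
  set cov : F → Prop := fun i => ∃ S, tight S ∧ i ∈ S with hcov
  set cls : F → Finset F := fun i => Finset.univ.filter (fun k => cov k ∧ T k = T i) with hcls
  have hclsint : ∀ i, cov i → IsIntR (∑ k ∈ cls i, w k) := by
    intro i hi
    set U := ((T i).filter (fun k => i ∉ T k)).biUnion T with hU
    have hcovT : ∀ k ∈ T i, cov k := fun k hk => ⟨T i, hT1 i hi, hk⟩
    have hUt : tight U := by
      have : ∀ A : Finset F, (∀ k ∈ A, cov k) → tight (A.biUnion T) := by
        intro A
        induction A using Finset.induction_on with
        | empty => intro _; simp [htight, h0]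
        | insert a s ha ih =>
          intro h
          rw [Finset.biUnion_insert]
          exact (hboth _ _ (hT1 a (h a (by simp))) (ih (fun k hk => h k (by simp [hk])))).1
      apply this
      intro k hk
      exact hcovT k (Finset.mem_filter.1 hk).1
    have hUsub : U ⊆ T i := by
      rw [hU, Finset.biUnion_subset]
      intro k hk
      have hk' := (Finset.mem_filter.1 hk).1
      exact hT3 k (hcovT k hk') _ (hT1 i hi) hk'
    have hEq : cls i = T i \ U := by
      ext k
      simp only [hcls, hU, Finset.mem_filter, Finset.mem_univ, true_and, Finset.mem_sdiff,
        Finset.mem_biUnion, not_exists, not_and, and_imp]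
      constructor
      · rintro ⟨hk, hkT⟩
        refine ⟨hkT ▸ hT2 k hk, fun m hm him hkm => him ?_⟩
        have := hT3 k hk _ (hT1 m (hcovT m hm)) hkm
        rw [hkT] at this
        exact this (hT2 i hi)
      · rintro ⟨hk, hno⟩
        have hck := hcovT k hk
        refine ⟨hck, ?_⟩
        have hik : i ∈ T k := by
          by_contra hik
          exact hno k hk hik (hT2 k hck)
        exact Finset.Subset.antisymm (hT3 k hck _ (hT1 i hi) hk) (hT3 i hi _ (hT1 k hck) hik)
    have hs := Finset.sum_sdiff (f := w) hUsub
    have ht := hT1 i hi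
    simp only [htight] at hUt ht
    refine ⟨ρ (T i) - ρ U, ?_⟩
    rw [hEq]
    push_cast
    linarith
  set E : Finset F := Finset.univ.filter (fun i => ¬ IsIntR (w i)) with hEdef
  set fr : Finset F → Finset F := fun S => S.filter (fun i => ¬ IsIntR (w i)) with hfr
  set A : Finset (Finset F) := (E.filter cov).image (fun i => fr (cls i)) with hAdef
  set B : Finset (Finset F) := (Finset.univ.filter
    (fun j : J => IsIntR (∑ i ∈ G j, w i) ∧ (fr (G j)).Nonempty)).image (fun j => fr (G j)) with hBdef
  have hfrE : ∀ S, fr S ⊆ E := by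
    intro S i hi
    simp only [hfr, Finset.mem_filter] at hi
    simp [hEdef, hi.2]
  have hself : ∀ i, cov i → i ∈ cls i := by
    intro i hi; simp [hcls, hi]
  obtain ⟨δ, hδ0, hδE, hδA, hδB⟩ := two_families E ⟨i0, by simp [hEdef, hi0]⟩ A B
    (by
      intro S hS
      obtain ⟨i, hi, rfl⟩ := Finset.mem_image.1 hS
      simp only [hEdef, Finset.mem_filter, Finset.mem_univ, true_and] at hi
      exact ⟨hfrE _, two_le_frac w _ (hclsint i hi.2) i (hself i hi.2) hi.1⟩)
    (by
      intro S hS S' hS' hne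
      obtain ⟨i, hi, rfl⟩ := Finset.mem_image.1 hS
      obtain ⟨k, hk, rfl⟩ := Finset.mem_image.1 hS'
      rw [Finset.disjoint_left]
      intro a ha hb
      apply hne
      simp only [hfr, hcls, Finset.mem_filter, Finset.mem_univ, true_and] at ha hb
      have : T i = T k := ha.1.2.symm.trans hb.1.2
      simp only [hcls, this])
    (by
      intro S hS
      obtain ⟨j, hj, rfl⟩ := Finset.mem_image.1 hS
      simp only [Finset.mem_filter, Finset.mem_univ, true_and] at hj
      obtain ⟨i, hi⟩ := hj.2
      have hi' := Finset.mem_filter.1 hi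
      exact ⟨hfrE _, two_le_frac w _ hj.1 i hi'.1 hi'.2⟩)
    (by
      intro S hS S' hS' hne
      obtain ⟨i, hi, rfl⟩ := Finset.mem_image.1 hS
      obtain ⟨k, hk, rfl⟩ := Finset.mem_image.1 hS'
      have hik : i ≠ k := by rintro rfl; exact hne rfl
      exact Finset.disjoint_of_subset_left (Finset.filter_subset _ _)
        (Finset.disjoint_of_subset_right (Finset.filter_subset _ _) (hG i k hik)))
  have hδi : ∀ i, IsIntR (w i) → δ i = 0 := fun i hi => hδE i (by simp [hEdef, hi])
  have hfrsum : ∀ S, ∑ i ∈ S, δ i = ∑ i ∈ fr S, δ i := by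
    intro S
    symm
    apply Finset.sum_subset (Finset.filter_subset _ _)
    intro i hi hni
    apply hδi
    by_contra hh
    exact hni (by simp [hi, hh])
  refine ⟨δ, hδ0, hδi, ?_, ?_⟩
  · intro S hS
    rw [← Finset.sum_fiberwise_of_maps_to (s := S) (t := S.image T) (g := T)
      (fun i hi => Finset.mem_image_of_mem T hi)]
    apply Finset.sum_eq_zero
    intro t ht
    obtain ⟨i, hi, rfl⟩ := Finset.mem_image.1 ht
    have hci : cov i := ⟨S, hS, hi⟩
    have hfib : S.filter (fun k => T k = T i) = cls i := by
      ext k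
      simp only [hcls, Finset.mem_filter, Finset.mem_univ, true_and]
      constructor
      · rintro ⟨hk, hkT⟩; exact ⟨⟨S, hS, hk⟩, hkT⟩
      · rintro ⟨hk, hkT⟩
        refine ⟨hT3 i hci S hS hi ?_, hkT⟩
        rw [← hkT]; exact hT2 k hk
    rw [hfib, hfrsum]
    rcases (fr (cls i)).eq_empty_or_nonempty with he | ⟨k, hk⟩
    · rw [he]; simp
    · apply hδA
      have hk' := Finset.mem_filter.1 hk
      have hkc := (Finset.mem_filter.1 hk'.1).2
      refine Finset.mem_image.2 ⟨k, ?_, ?_⟩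
      · simp [hEdef, hk'.2, hkc.1]
      · simp only [hcls, hkc.2]
  · intro j hj
    rw [hfrsum]
    rcases (fr (G j)).eq_empty_or_nonempty with he | hne
    · rw [he]; simp
    · exact hδB _ (Finset.mem_image.2 ⟨j, by simp [hj, hne], rfl⟩)

theorem polymatroid_integral {F J : Type*} [Fintype F] [Fintype J]
    (ρ : Finset F → ℤ) (h0 : ρ ∅ = 0)
    (hsub : ∀ S T, ρ (S ∪ T) + ρ (S ∩ T) ≤ ρ S + ρ T)
    (G : J → Finset F) (hG : ∀ j k, j ≠ k → Disjoint (G j) (G k))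
    (l u : J → ℤ) (cost : F → ℝ)
    (w0 : F → ℝ) (hw0 : ∀ i, 0 ≤ w0 i) (hwρ : ∀ S, ∑ i ∈ S, w0 i ≤ (ρ S : ℝ))
    (hl : ∀ j, (l j : ℝ) ≤ ∑ i ∈ G j, w0 i) (hu : ∀ j, ∑ i ∈ G j, w0 i ≤ (u j : ℝ)) :
    ∃ z : F → ℤ, (∀ i, 0 ≤ z i) ∧ (∀ S, ∑ i ∈ S, z i ≤ ρ S) ∧
      (∀ j, l j ≤ ∑ i ∈ G j, z i) ∧ (∀ j, ∑ i ∈ G j, z i ≤ u j) ∧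
      ∑ i, cost i * (z i : ℝ) ≤ ∑ i, cost i * w0 i := by
  set P : Set (F → ℝ) := {w | (∀ i, 0 ≤ w i) ∧ (∀ S : Finset F, ∑ i ∈ S, w i ≤ (ρ S : ℝ)) ∧
    (∀ j, (l j : ℝ) ≤ ∑ i ∈ G j, w i) ∧ (∀ j, ∑ i ∈ G j, w i ≤ (u j : ℝ))} with hP
  have hPclosed : IsClosed P := by
    have : P = (⋂ i, {w : F → ℝ | 0 ≤ w i}) ∩ ((⋂ S : Finset F, {w : F → ℝ | ∑ i ∈ S, w i ≤ (ρ S : ℝ)}) ∩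
      ((⋂ j, {w : F → ℝ | (l j : ℝ) ≤ ∑ i ∈ G j, w i}) ∩ ⋂ j, {w : F → ℝ | ∑ i ∈ G j, w i ≤ (u j : ℝ)})) := by
      ext w; simp [hP]
    rw [this]
    refine (isClosed_iInter fun i => isClosed_le (by fun_prop) (by fun_prop)).inter
      ((isClosed_iInter fun i => isClosed_le (by fun_prop) (by fun_prop)).inter
      ((isClosed_iInter fun i => isClosed_le (by fun_prop) (by fun_prop)).inter
      (isClosed_iInter fun i => isClosed_le (by fun_prop) (by fun_prop))))
  have hPcomp : IsCompact P := by
    apply IsCompact.of_isClosed_subset (isCompact_univ_pi (fun i : F => isCompact_Icc (a := (0:ℝ)) (b := (ρ {i} : ℝ)))) hPclosed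
    intro w hw i _
    exact ⟨hw.1 i, by simpa using hw.2.1 {i}⟩
  have hw0P : w0 ∈ P := ⟨hw0, hwρ, hl, hu⟩
  let L : (F → ℝ) →L[ℝ] ℝ := - ∑ i, cost i • (ContinuousLinearMap.proj i : (F → ℝ) →L[ℝ] ℝ)
  have hLval : ∀ w, L w = - ∑ i, cost i * w i := by
    intro w; simp [L]
  have hexp := ContinuousLinearMap.toExposed.isExposed (𝕜 := ℝ) (l := L) (A := P)
  have hne : (L.toExposed P).Nonempty := by
    obtain ⟨v, hv, hvm⟩ := hPcomp.exists_isMaxOn ⟨w0, hw0P⟩ L.continuous.continuousOn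
    exact ⟨v, hv, fun y hy => hvm hy⟩
  obtain ⟨w, hw⟩ := (hexp.isCompact hPcomp).extremePoints_nonempty hne
  have hwP : w ∈ P.extremePoints ℝ := hexp.isExtreme.extremePoints_subset_extremePoints hw
  have hwmin : ∑ i, cost i * w i ≤ ∑ i, cost i * w0 i := by
    have := (extremePoints_subset hw).2 w0 hw0P
    rw [hLval, hLval] at this
    linarith
  have hwf : w ∈ P := extremePoints_subset hwP
  have hint : ∀ i, IsIntR (w i) := by
    by_contra hcon
    push Not at hcon
    obtain ⟨i0, hi0⟩ := hcon
    obtain ⟨δ, hδ0, hδi, hδS, hδG⟩ := direction_exists ρ h0 hsub G hG w hwf.2.1 i0 hi0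
    -- small perturbations remain feasible
    have hev : ∀ᶠ ε in nhds (0:ℝ), w + ε • δ ∈ P := by
      have hsum : ∀ (S : Finset F) (ε : ℝ), ∑ i ∈ S, (w + ε • δ) i = ∑ i ∈ S, w i + ε * ∑ i ∈ S, δ i := by
        intro S ε
        simp [Finset.sum_add_distrib, Finset.mul_sum]
      have hlt : ∀ (a b r : ℝ), a < r → ∀ᶠ ε in nhds (0:ℝ), a + ε * b ≤ r := by
        intro a b r har
        have hc : ContinuousAt (fun ε : ℝ => a + ε * b) 0 := by fun_prop
        have := hc.eventually_lt (continuousAt_const (y := r)) (by simpa using har)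
        exact this.mono fun _ h => h.le
      have hgt : ∀ (a b r : ℝ), r < a → ∀ᶠ ε in nhds (0:ℝ), r ≤ a + ε * b := by
        intro a b r har
        have hc : ContinuousAt (fun ε : ℝ => a + ε * b) 0 := by fun_prop
        have := (continuousAt_const (y := r)).eventually_lt hc (by simpa using har)
        exact this.mono fun _ h => h.le
      have e1 : ∀ᶠ ε in nhds (0:ℝ), ∀ i, 0 ≤ (w + ε • δ) i := by
        rw [Filter.eventually_all]
        intro i
        by_cases hi : IsIntR (w i)
        · exact Filter.Eventually.of_forall fun ε => by simpa [hδi i hi] using hwf.1 i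
        · have : 0 < w i := lt_of_le_of_ne (hwf.1 i) (fun h => hi ⟨0, by simpa using h⟩)
          simpa using hgt (w i) (δ i) 0 this
      have e2 : ∀ᶠ ε in nhds (0:ℝ), ∀ S : Finset F, ∑ i ∈ S, (w + ε • δ) i ≤ (ρ S : ℝ) := by
        rw [Filter.eventually_all]
        intro S
        simp only [hsum]
        rcases (hwf.2.1 S).eq_or_lt with h | h
        · exact Filter.Eventually.of_forall fun ε => by rw [hδS S h, h]; simp
        · exact hlt _ _ _ h
      have e3 : ∀ᶠ ε in nhds (0:ℝ), ∀ j, (l j : ℝ) ≤ ∑ i ∈ G j, (w + ε • δ) i := by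
        rw [Filter.eventually_all]
        intro j
        simp only [hsum]
        rcases (hwf.2.2.1 j).eq_or_lt with h | h
        · exact Filter.Eventually.of_forall fun ε => by rw [hδG j ⟨_, h⟩, ← h]; simp
        · exact hgt _ _ _ h
      have e4 : ∀ᶠ ε in nhds (0:ℝ), ∀ j, ∑ i ∈ G j, (w + ε • δ) i ≤ (u j : ℝ) := by
        rw [Filter.eventually_all]
        intro j
        simp only [hsum]
        rcases (hwf.2.2.2 j).eq_or_lt with h | h
        · exact Filter.Eventually.of_forall fun ε => by rw [hδG j ⟨_, h.symm⟩, h]; simp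
        · exact hlt _ _ _ h
      filter_upwards [e1, e2, e3, e4] with ε a b c d
      exact ⟨a, b, c, d⟩
    obtain ⟨ε, hεpos, hε⟩ := Metric.eventually_nhds_iff.1 hev
    have hp : w + (ε/2) • δ ∈ P := hε (by simp [abs_of_pos hεpos]; linarith)
    have hm : w + (-(ε/2)) • δ ∈ P := hε (by simp [abs_of_pos hεpos]; linarith)
    have hseg : w ∈ openSegment ℝ (w + (ε/2) • δ) (w + (-(ε/2)) • δ) := by
      refine ⟨1/2, 1/2, by norm_num, by norm_num, by norm_num, ?_⟩
      ext i; simp; ring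
    have := (mem_extremePoints.1 hwP).2 _ hp _ hm hseg
    apply hδ0
    have h1 := this.1
    have h2 : (ε/2) • δ = 0 := by simpa using h1
    rcases smul_eq_zero.1 h2 with h | h
    · linarith
    · exact h
  choose z hz using hint
  refine ⟨z, ?_, ?_, ?_, ?_, ?_⟩
  · intro i; have := hwf.1 i; rw [← hz] at this; exact_mod_cast this
  · intro S; have := hwf.2.1 S; simp only [← hz] at this; exact_mod_cast this
  · intro j; have := hwf.2.2.1 j; simp only [← hz] at this; exact_mod_cast this
  · intro j; have := hwf.2.2.2 j; simp only [← hz] at this; exact_mod_cast this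
  · simp only [hz]; exact hwmin

theorem matroidRank_eq {F : Type*} [Fintype F] (M : Matroid F) (S : Finset F) :
    ((matroidRank M S : ℕ) : ℕ∞) = M.eRk (S : Set F) := by
  apply le_antisymm
  · rw [Matroid.le_eRk_iff]
    have hne : (S.powerset.filter (fun I : Finset F => M.Indep ↑I)).Nonempty :=
      ⟨∅, by simp⟩
    obtain ⟨I, hI, hIc⟩ := Finset.exists_mem_eq_sup _ hne Finset.card
    simp only [Finset.mem_filter, Finset.mem_powerset] at hI
    refine ⟨I, by exact_mod_cast hI.1, hI.2, ?_⟩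
    rw [Set.encard_coe_eq_coe_finsetCard, matroidRank, hIc]
  · rw [Matroid.eRk_le_iff]
    intro I hIS hI
    have hfin : I.Finite := Set.toFinite I
    obtain ⟨I', rfl⟩ := hfin.exists_finset_coe
    rw [Set.encard_coe_eq_coe_finsetCard]
    exact_mod_cast Finset.le_sup (f := Finset.card)
      (s := S.powerset.filter (fun I : Finset F => M.Indep ↑I)) (b := I')
      (by simp only [Finset.mem_filter, Finset.mem_powerset]; exact ⟨by exact_mod_cast hIS, hI⟩)

theorem matroidRank_empty {F : Type*} [Fintype F] (M : Matroid F) : matroidRank M ∅ = 0 := by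
  have := matroidRank_eq M ∅
  simpa using this

theorem matroidRank_submod {F : Type*} [Fintype F] (M : Matroid F) (S T : Finset F) :
    matroidRank M (S ∪ T) + matroidRank M (S ∩ T) ≤ matroidRank M S + matroidRank M T := by
  have := M.eRk_inter_add_eRk_union_le (S : Set F) (T : Set F)
  rw [← Finset.coe_inter, ← Finset.coe_union] at this
  simp only [← matroidRank_eq] at this
  norm_cast at this
  omega

theorem matroidRank_singleton {F : Type*} [Fintype F] (M : Matroid F) (i : F) :
    matroidRank M {i} ≤ 1 := by
  have h := M.eRk_le_encard (({i} : Finset F) : Set F)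
  rw [← matroidRank_eq, Set.encard_coe_eq_coe_finsetCard] at h
  simpa using h

theorem indep_of_card_le {F : Type*} [Fintype F] (M : Matroid F) (S : Finset F)
    (h : S.card ≤ matroidRank M S) : M.Indep (S : Set F) := by
  rw [Matroid.indep_iff_eRk_eq_encard_of_finite (Finset.finite_toSet S)]
  apply le_antisymm (M.eRk_le_encard _)
  rw [← matroidRank_eq, Set.encard_coe_eq_coe_finsetCard]
  exact_mod_cast h

/-- Greedy clustering. -/
theorem greedy_cluster {D : Type*} [Fintype D] (κ : D → ℝ) (R : D → D → Prop)
    (hR : ∀ j k, R j k → R k j) :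
    ∃ S : Finset D, (∀ j ∈ S, ∀ k ∈ S, j ≠ k → ¬ R j k) ∧
      ∀ j, j ∉ S → ∃ k ∈ S, R j k ∧ κ k ≤ κ j := by
  have main : ∀ A : Finset D, ∃ S ⊆ A, (∀ j ∈ S, ∀ k ∈ S, j ≠ k → ¬ R j k) ∧
      ∀ j ∈ A, j ∉ S → ∃ k ∈ S, R j k ∧ κ k ≤ κ j := by
    intro A
    induction A using Finset.strongInduction with
    | H A ih =>
      rcases A.eq_empty_or_nonempty with rfl | hne
      · exact ⟨∅, by simp, by simp, by simp⟩
      obtain ⟨m, hm, hmax⟩ := Finset.exists_max_image A κ hne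
      obtain ⟨S, hSA, h1, h2⟩ := ih (A.erase m) (Finset.erase_ssubset hm)
      by_cases hc : ∃ k ∈ S, R m k
      · refine ⟨S, hSA.trans (Finset.erase_subset _ _), h1, fun j hj hjS => ?_⟩
        by_cases hjm : j = m
        · subst hjm
          obtain ⟨k, hk, hkR⟩ := hc
          exact ⟨k, hk, hkR, hmax k (Finset.mem_of_mem_erase (hSA hk))⟩
        · exact h2 j (by simp [hjm, hj]) hjS
      · push Not at hc
        refine ⟨insert m S, ?_, ?_, ?_⟩
        · exact Finset.insert_subset hm (hSA.trans (Finset.erase_subset _ _))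
        · intro j hj k hk hjk
          rw [Finset.mem_insert] at hj hk
          rcases hj with rfl | hj
          · rcases hk with rfl | hk
            · exact absurd rfl hjk
            · exact hc k hk
          · rcases hk with rfl | hk
            · exact fun h => hc j hj (hR _ _ h)
            · exact h1 j hj k hk hjk
        · intro j hj hjS
          rw [Finset.mem_insert, not_or] at hjS
          obtain ⟨k, hk, h⟩ := h2 j (by simp [hjS.1, hj]) hjS.2
          exact ⟨k, Finset.mem_insert_of_mem hk, h⟩
  obtain ⟨S, _, h1, h2⟩ := main Finset.univ
  exact ⟨S, h1, fun j hj => h2 j (Finset.mem_univ j) hj⟩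

theorem half_to_int {F C : Type*} [Fintype F] [Fintype C]
    (c : F ⊕ C → F ⊕ C → ℝ)
    (hc_nonneg : ∀ u v, 0 ≤ c u v)
    (hc_symm : ∀ u v, c u v = c v u)
    (hc_tri : ∀ u v w, c u w ≤ c u v + c v w)
    (f : F → ℝ) (d : C → ℝ) (hd : ∀ j, 0 ≤ d j)
    (M : Matroid F)
    (G : C → Finset F) (hG : ∀ j k, j ≠ k → Disjoint (G j) (G k))
    (γ : C → ℝ) (s : C → C) (w : F → ℤ) (hw0 : ∀ i, 0 ≤ w i)
    (hwρ : ∀ S : Finset F, ∑ i ∈ S, w i ≤ 2 * (matroidRank M S : ℤ))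
    (h1 : ∀ j, 1 ≤ ∑ i ∈ G j, w i) (h2 : ∀ j, ∑ i ∈ G j, w i ≤ 2)
    (hB : ∀ j, ∑ i ∈ G j, w i = 1 → s j ≠ j ∧ c (Sum.inr j) (Sum.inr (s j)) ≤ 2 * γ j)
    (hsep : ∀ j k, k ≠ j → ∀ i ∈ G k, ∀ i' ∈ G j,
      c (Sum.inl i) (Sum.inr k) ≤ c (Sum.inl i') (Sum.inr k)) :
    ∃ (Fs : Finset F) (σ : C → F), M.Indep ↑Fs ∧ (∀ j, σ j ∈ Fs) ∧
      (∑ i ∈ Fs, f i) + ∑ j, d j * c (Sum.inl (σ j)) (Sum.inr j) ≤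
        (∑ i, f i * ((w i : ℝ) / 2)) + ∑ j, d j * (∑ i ∈ G j, c (Sum.inl i) (Sum.inr j) * (w i : ℝ)
          + 2 * γ j * (2 - ∑ i ∈ G j, (w i : ℝ))) := by
  -- primary facilities
  have hp : ∀ j, ∃ i ∈ G j, 1 ≤ w i := by
    intro j
    by_contra hcon
    push Not at hcon
    have : ∑ i ∈ G j, w i ≤ 0 := Finset.sum_nonpos (fun i hi => by have := hcon i hi; omega)
    have := h1 j
    omega
  choose p hpG hpw using hp
  set isA : C → Prop := fun j => ∑ i ∈ G j, w i = 2 with hisA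
  have hnA : ∀ j, ¬ isA j → ∑ i ∈ G j, w i = 1 := by
    intro j hj
    have a := h1 j
    have b := h2 j
    simp only [hisA] at hj
    omega
  have hpw1 : ∀ j, ¬ isA j → w (p j) = 1 := by
    intro j hj
    have a := hnA j hj
    have b := Finset.single_le_sum (f := w) (fun i _ => hw0 i) (hpG j)
    have := hpw j
    omega
  set a : C → ℝ := fun j => c (Sum.inl (p j)) (Sum.inr j) with ha
  set b : C → ℝ := fun j => c (Sum.inr j) (Sum.inr (s j)) with hb
  have ha0 : ∀ j, 0 ≤ a j := fun j => hc_nonneg _ _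
  have hb0 : ∀ j, 0 ≤ b j := fun j => hc_nonneg _ _
  set t : C → Finset C := fun j => if isA j then {j} else {j, s j} with ht
  set κ : C → ℝ := fun j => if isA j then -1 else a j + b j + a (s j) with hκ
  obtain ⟨S, hS1, hS2⟩ := greedy_cluster κ (fun j k => ¬ Disjoint (t j) (t k))
    (fun j k h h' => h h'.symm)
  have htA : ∀ j, isA j → t j = {j} := fun j hj => by simp [ht, hj]
  have htB : ∀ j, ¬ isA j → t j = {j, s j} := fun j hj => by simp [ht, hj]
  have hκA : ∀ j, isA j → κ j = -1 := fun j hj => by simp [hκ, hj]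
  have hκB : ∀ j, ¬ isA j → κ j = a j + b j + a (s j) := fun j hj => by simp [hκ, hj]
  have hAS : ∀ j, isA j → j ∈ S := by
    intro j hj
    by_contra hjS
    obtain ⟨k, hk, hkd, hle⟩ := hS2 j hjS
    rw [hκA j hj] at hle
    have hkA : isA k := by
      by_contra hkA
      rw [hκB k hkA] at hle
      have := ha0 k
      have := hb0 k
      have := ha0 (s k)
      linarith
    rw [htA j hj, htA k hkA] at hkd
    simp only [Finset.disjoint_singleton, ne_eq, not_not] at hkd
    exact hjS (hkd ▸ hk)
  have hsB : ∀ j ∈ S, ¬ isA j → ¬ isA (s j) := by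
    intro j hjS hj hsA
    have hne := (hB j (hnA j hj)).1
    apply hS1 j hjS (s j) (hAS _ hsA) (Ne.symm hne)
    rw [htA _ hsA, htB j hj]
    simp
  set Γ : C → Finset F := fun j => if isA j then G j else {p j, p (s j)} with hΓ
  have hΓA : ∀ j, isA j → Γ j = G j := fun j hj => by simp [hΓ, hj]
  have hΓB : ∀ j, ¬ isA j → Γ j = {p j, p (s j)} := fun j hj => by simp [hΓ, hj]
  have hΓt : ∀ j, ∀ i ∈ Γ j, ∃ k ∈ t j, i ∈ G k := by
    intro j i hi
    by_cases hj : isA j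
    · rw [hΓA j hj] at hi
      exact ⟨j, by simp [htA j hj], hi⟩
    · rw [hΓB j hj] at hi
      simp only [Finset.mem_insert, Finset.mem_singleton] at hi
      rcases hi with rfl | rfl
      · exact ⟨j, by simp [htB j hj], hpG j⟩
      · exact ⟨s j, by simp [htB j hj], hpG (s j)⟩
  have hΓd : ∀ j k : S, j ≠ k → Disjoint (Γ j) (Γ k) := by
    intro j k hjk
    have hdis : Disjoint (t j) (t k) := by
      have := hS1 j j.2 k k.2 (fun h => hjk (Subtype.ext h))
      simpa using this
    rw [Finset.disjoint_left]
    intro i hi hi'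
    obtain ⟨m, hm, him⟩ := hΓt j i hi
    obtain ⟨n, hn, hin⟩ := hΓt k i hi'
    have hmn : m = n := by
      by_contra hmn
      exact Finset.disjoint_left.1 (hG m n hmn) him hin
    subst hmn
    exact Finset.disjoint_left.1 hdis hm hn
  have hpne : ∀ j, ¬ isA j → p j ≠ p (s j) := by
    intro j hj h
    have hne := (hB j (hnA j hj)).1
    have h' := hpG (s j)
    rw [← h] at h'
    exact Finset.disjoint_left.1 (hG _ _ hne) h' (hpG j)
  have hΓw : ∀ j ∈ S, ∑ i ∈ Γ j, w i = 2 := by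
    intro j hjS
    by_cases hj : isA j
    · rw [hΓA j hj]; exact hj
    · rw [hΓB j hj, Finset.sum_pair (hpne j hj), hpw1 j hj, hpw1 (s j) (hsB j hjS hj)]
      norm_num
  have hΓw' : ∀ j : S, ∑ i ∈ Γ j, ((w i : ℝ) / 2) = 1 := by
    intro j
    rw [← Finset.sum_div]
    have : ((∑ i ∈ Γ j, w i : ℤ) : ℝ) = 2 := by rw [hΓw j j.2]; norm_num
    push_cast at this
    rw [this]; norm_num
  -- the linear cost
  set K : C → F → ℝ := fun j i => if isA j then (if i ∈ G j then c (Sum.inl i) (Sum.inr j) else 0)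
    else (if i = p j then - (4 * γ j) else 0) with hK
  set k0 : C → ℝ := fun j => if isA j then 0 else a j + 4 * γ j with hk0
  have hKA : ∀ j, isA j → ∀ v : F → ℝ, k0 j + ∑ i, K j i * v i =
      ∑ i ∈ G j, c (Sum.inl i) (Sum.inr j) * v i := by
    intro j hj v
    simp [hK, hk0, hj, Finset.sum_ite_mem, ite_mul]
  have hKB : ∀ j, ¬ isA j → ∀ v : F → ℝ, k0 j + ∑ i, K j i * v i =
      a j + 4 * γ j * (1 - v (p j)) := by
    intro j hj v
    simp [hK, hk0, hj, ite_mul]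
    ring
  have hlin : ∀ v : F → ℝ, ∑ i, (f i + ∑ j, d j * K j i) * v i =
      ∑ i, f i * v i + ∑ j, d j * ∑ i, K j i * v i := by
    intro v
    simp only [add_mul, Finset.sum_add_distrib, Finset.sum_mul, Finset.mul_sum]
    rw [Finset.sum_comm]
    simp only [mul_assoc]
  obtain ⟨z, hz0, hzρ, hzl, hzu, hzc⟩ := polymatroid_integral (J := S)
    (fun S => (matroidRank M S : ℤ))
    (by simp [matroidRank_empty]) (by intro S T; exact_mod_cast matroidRank_submod M S T)
    (fun j => Γ j) hΓd (fun _ => 1) (fun _ => 1) (fun i => f i + ∑ j, d j * K j i)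
    (fun i => (w i : ℝ) / 2) (fun i => by have := hw0 i; positivity)
    (by
      intro T
      rw [← Finset.sum_div]
      have : ((∑ i ∈ T, w i : ℤ) : ℝ) ≤ ((2 * (matroidRank M T : ℤ) : ℤ) : ℝ) := by
        exact_mod_cast hwρ T
      push_cast at this ⊢
      linarith)
    (fun j => by simp only [hΓw' j]; norm_num) (fun j => by simp only [hΓw' j]; norm_num)
  have hz1 : ∀ i, z i ≤ 1 := by
    intro i
    have hh := hzρ {i}
    have h' := matroidRank_singleton M i
    simp only [Finset.sum_singleton] at hh
    omega
  have hopen : ∀ j ∈ S, ∃ i ∈ Γ j, z i = 1 := by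
    intro j hj
    by_contra hcon
    push Not at hcon
    have : ∑ i ∈ Γ j, z i ≤ 0 := Finset.sum_nonpos (fun i hi => by
      have := hcon i hi; have := hz1 i; omega)
    have := hzl ⟨j, hj⟩
    simp only at this
    omega
  have hstar : ∀ j, ¬ isA j → ∀ i ∈ G (s j), c (Sum.inl i) (Sum.inr (s j)) ≤ a j + b j := by
    intro j hj i hi
    have e1 := hsep j (s j) (hB j (hnA j hj)).1 i hi (p j) (hpG j)
    have e2 := hc_tri (Sum.inl (p j)) (Sum.inr j) (Sum.inr (s j))
    simp only [ha, hb]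
    linarith
  have hstar2 : ∀ j, ¬ isA j → ∀ i ∈ G (s j), c (Sum.inl i) (Sum.inr j) ≤ a j + 2 * b j := by
    intro j hj i hi
    have e1 := hstar j hj i hi
    have e2 := hc_tri (Sum.inl i) (Sum.inr (s j)) (Sum.inr j)
    have e3 := hc_symm (Sum.inr (s j)) (Sum.inr j)
    have e4 : b j = c (Sum.inr j) (Sum.inr (s j)) := rfl
    linarith
  -- per client claim
  have hclaim : ∀ j, ∃ i, z i = 1 ∧ c (Sum.inl i) (Sum.inr j) ≤ k0 j + ∑ i, K j i * (z i : ℝ) := by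
    intro j
    by_cases hj : isA j
    · obtain ⟨i, hi, hzi⟩ := hopen j (hAS j hj)
      rw [hΓA j hj] at hi
      refine ⟨i, hzi, ?_⟩
      rw [hKA j hj (fun i => (z i : ℝ))]
      have := Finset.single_le_sum (f := fun i => c (Sum.inl i) (Sum.inr j) * (z i : ℝ))
        (fun k _ => mul_nonneg (hc_nonneg _ _) (by exact_mod_cast hz0 k)) hi
      simpa [hzi] using this
    · rw [hKB j hj (fun i => (z i : ℝ))]
      by_cases hzp : z (p j) = 1
      · exact ⟨p j, hzp, by simp [hzp, ha]⟩
      have hzp0 : z (p j) = 0 := by have := hz0 (p j); have := hz1 (p j); omega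
      have hbγ : b j ≤ 2 * γ j := (hB j (hnA j hj)).2
      suffices h : ∃ i, z i = 1 ∧ c (Sum.inl i) (Sum.inr j) ≤ a j + 2 * b j by
        obtain ⟨i, hi, hle⟩ := h
        refine ⟨i, hi, ?_⟩
        simp only [hzp0]
        push_cast
        linarith
      have ho : ∃ o ∈ S, ¬ Disjoint (t j) (t o) ∧ κ o ≤ κ j := by
        by_cases hjS : j ∈ S
        · exact ⟨j, hjS, by simp [htB j hj], le_rfl⟩
        · exact hS2 j hjS
      obtain ⟨o, hoS, hoD, hoκ⟩ := ho
      obtain ⟨i, hi, hzi⟩ := hopen o hoS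
      refine ⟨i, hzi, ?_⟩
      have hij : i ≠ p j := by rintro rfl; exact hzp hzi
      by_cases hoA : isA o
      · rw [htB j hj, htA o hoA] at hoD
        simp only [Finset.disjoint_singleton_right, Finset.mem_insert, Finset.mem_singleton,
          not_not] at hoD
        have hos : o = s j := by
          rcases hoD with rfl | h
          · exact absurd hoA hj
          · exact h
        subst hos
        rw [hΓA _ hoA] at hi
        exact hstar2 j hj i hi
      · rw [hΓB o hoA] at hi
        simp only [Finset.mem_insert, Finset.mem_singleton] at hi
        rw [hκB o hoA, hκB j hj] at hoκ
        have hinter : o = j ∨ o = s j ∨ s o = j ∨ s o = s j := by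
          rw [htB j hj, htB o hoA, Finset.not_disjoint_iff] at hoD
          obtain ⟨m, hm, hm'⟩ := hoD
          simp only [Finset.mem_insert, Finset.mem_singleton] at hm hm'
          rcases hm with rfl | rfl <;> rcases hm' with h | h <;> simp [h]
        have hao := ha0 o
        have hbo := hb0 o
        have hbj := hb0 j
        have hasj := hstar j hj (p (s j)) (hpG (s j))
        change a (s j) ≤ _ at hasj
        have hpo : c (Sum.inl (p o)) (Sum.inr o) = a o := rfl
        have hpso : c (Sum.inl (p (s o))) (Sum.inr (s o)) = a (s o) := rfl
        have hbo' : c (Sum.inr o) (Sum.inr (s o)) = b o := rfl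
        have hbo'' : c (Sum.inr (s o)) (Sum.inr o) = b o := hc_symm _ _
        have hbj'' : c (Sum.inr (s j)) (Sum.inr j) = b j := hc_symm _ _
        rcases hinter with h | h | h | h
        · subst h
          rcases hi with h' | h'
          · exact absurd h' hij
          · rw [h']; exact hstar2 _ hj _ (hpG _)
        · rcases hi with h' | h'
          · rw [h', h]; exact hstar2 _ hj _ (hpG _)
          · rw [h']
            have e1 := hc_tri (Sum.inl (p (s o))) (Sum.inr (s o)) (Sum.inr j)
            have e2 := hc_tri (Sum.inr (s o)) (Sum.inr o) (Sum.inr j)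
            have e3 : c (Sum.inr o) (Sum.inr j) = b j := by rw [h]; exact hbj''
            have e4 : a (s j) = a o := by rw [h]
            linarith
        · rcases hi with h' | h'
          · rw [h']
            have e1 := hc_tri (Sum.inl (p o)) (Sum.inr o) (Sum.inr j)
            have e3 : c (Sum.inr o) (Sum.inr j) = b o := by rw [← h]
            have e4 : a (s o) = a j := by rw [h]
            linarith
          · rw [h] at h'
            exact absurd h' hij
        · rcases hi with h' | h'
          · rw [h']
            have e1 := hc_tri (Sum.inl (p o)) (Sum.inr o) (Sum.inr j)
            have e2 := hc_tri (Sum.inr o) (Sum.inr (s o)) (Sum.inr j)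
            have e3 : c (Sum.inr (s o)) (Sum.inr j) = b j := by rw [h]; exact hbj''
            have e4 : a (s o) = a (s j) := by rw [h]
            linarith
          · rw [h', h]; exact hstar2 _ hj _ (hpG _)
  choose σ hσ1 hσ2 using hclaim
  set Fs : Finset F := Finset.univ.filter (fun i => z i = 1) with hFs
  refine ⟨Fs, σ, ?_, ?_, ?_⟩
  · apply indep_of_card_le
    have hh := hzρ Fs
    have : ∑ i ∈ Fs, z i = (Fs.card : ℤ) := by
      calc ∑ i ∈ Fs, z i = ∑ i ∈ Fs, (1 : ℤ) :=
            Finset.sum_congr rfl (fun i hi => (Finset.mem_filter.1 hi).2)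
        _ = (Fs.card : ℤ) := by simp only [Finset.sum_const, nsmul_eq_mul, mul_one]
    rw [this] at hh
    exact_mod_cast hh
  · intro j; simp [hFs, hσ1 j]
  · have hfz : ∑ i ∈ Fs, f i = ∑ i, f i * (z i : ℝ) := by
      rw [hFs, Finset.sum_filter]
      apply Finset.sum_congr rfl
      intro i _
      by_cases hi : z i = 1
      · simp [hi]
      · have : z i = 0 := by have := hz0 i; have := hz1 i; omega
        simp [this]
    rw [hlin (fun i => (z i : ℝ)), hlin (fun i => (w i : ℝ) / 2)] at hzc
    have e1 : ∑ j, d j * c (Sum.inl (σ j)) (Sum.inr j) ≤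
        ∑ j, d j * k0 j + ∑ j, d j * ∑ i, K j i * (z i : ℝ) := by
      rw [← Finset.sum_add_distrib]
      apply Finset.sum_le_sum
      intro j _
      rw [← mul_add]
      exact mul_le_mul_of_nonneg_left (hσ2 j) (hd j)
    have e2 : ∑ j, d j * k0 j + ∑ j, d j * ∑ i, K j i * ((w i : ℝ) / 2) ≤
        ∑ j, d j * (∑ i ∈ G j, c (Sum.inl i) (Sum.inr j) * (w i : ℝ)
          + 2 * γ j * (2 - ∑ i ∈ G j, (w i : ℝ))) := by
      rw [← Finset.sum_add_distrib]
      apply Finset.sum_le_sum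
      intro j _
      rw [← mul_add]
      apply mul_le_mul_of_nonneg_left _ (hd j)
      have hwnn : ∀ i ∈ G j, 0 ≤ c (Sum.inl i) (Sum.inr j) * (w i : ℝ) := fun i _ =>
        mul_nonneg (hc_nonneg _ _) (by exact_mod_cast hw0 i)
      by_cases hj : isA j
      · rw [hKA j hj (fun i => (w i : ℝ) / 2)]
        have : ∑ i ∈ G j, (w i : ℝ) = 2 := by exact_mod_cast hj
        rw [this]
        have hnn := Finset.sum_nonneg hwnn
        have : ∑ i ∈ G j, c (Sum.inl i) (Sum.inr j) * ((w i : ℝ) / 2) =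
          (∑ i ∈ G j, c (Sum.inl i) (Sum.inr j) * (w i : ℝ)) / 2 := by
          rw [Finset.sum_div]; exact Finset.sum_congr rfl fun i _ => by ring
        rw [this]
        linarith
      · rw [hKB j hj (fun i => (w i : ℝ) / 2)]
        have : ∑ i ∈ G j, (w i : ℝ) = 1 := by exact_mod_cast hnA j hj
        rw [this, hpw1 j hj]
        have h' := Finset.single_le_sum hwnn (hpG j)
        rw [hpw1 j hj] at h'
        have h'' : c (Sum.inl (p j)) (Sum.inr j) = a j := rfl
        push_cast at h' ⊢
        linarith
    rw [hfz]
    linarith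

theorem cluster_round {F C : Type*} [Fintype F] [Fintype C]
    (c : F ⊕ C → F ⊕ C → ℝ)
    (hc_nonneg : ∀ u v, 0 ≤ c u v)
    (hc_symm : ∀ u v, c u v = c v u)
    (hc_tri : ∀ u v w, c u w ≤ c u v + c v w)
    (f : F → ℝ) (hf : ∀ i, 0 ≤ f i) (d : C → ℝ) (hd : ∀ j, 0 ≤ d j)
    (M : Matroid F)
    (x : F → C → ℝ) (y : F → ℝ)
    (hx : ∀ i j, 0 ≤ x i j) (hy : ∀ i, 0 ≤ y i)
    (hx1 : ∀ j, ∑ i, x i j = 1)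
    (hxy : ∀ i j, x i j ≤ y i)
    (hrank : ∀ S : Finset F, ∑ i ∈ S, y i ≤ (matroidRank M S : ℝ))
    (Cb : C → ℝ) (hCb : ∀ j, Cb j = ∑ i, c (Sum.inl i) (Sum.inr j) * x i j)
    (hfar : ∀ j k, j ≠ k → 4 * Cb j < c (Sum.inr j) (Sum.inr k)) :
    ∃ (Fs : Finset F) (σ : C → F), M.Indep ↑Fs ∧ (∀ j, σ j ∈ Fs) ∧
      (∑ i ∈ Fs, f i) + ∑ j, d j * c (Sum.inl (σ j)) (Sum.inr j) ≤
        (∑ i, f i * y i) + 4 * ∑ j, d j * Cb j := by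
  rcases isEmpty_or_nonempty C with hCe | hCne
  · refine ⟨∅, fun j => hCe.elim j, by simp, fun j => hCe.elim j, ?_⟩
    simp only [Finset.sum_empty, Finset.univ_eq_empty, add_zero, mul_zero]
    exact Finset.sum_nonneg (fun i _ => mul_nonneg (hf i) (hy i))
  have ho : ∀ i : F, ∃ k : C, ∀ k', c (Sum.inl i) (Sum.inr k) ≤ c (Sum.inl i) (Sum.inr k') :=
    fun i => Finite.exists_min (fun k => c (Sum.inl i) (Sum.inr k))
  choose o ho using ho
  set G : C → Finset F := fun j => Finset.univ.filter (fun i => o i = j ∧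
    ∀ i', o i' ≠ j → c (Sum.inl i) (Sum.inr j) ≤ c (Sum.inl i') (Sum.inr j)) with hGdef
  have hGmem : ∀ j i, i ∈ G j ↔ (o i = j ∧
    ∀ i', o i' ≠ j → c (Sum.inl i) (Sum.inr j) ≤ c (Sum.inl i') (Sum.inr j)) := by
    intro j i; simp [hGdef]
  have hGd : ∀ j k, j ≠ k → Disjoint (G j) (G k) := by
    intro j k hjk
    rw [Finset.disjoint_left]
    intro i hi hi'
    exact hjk (((hGmem j i).1 hi).1.symm.trans ((hGmem k i).1 hi').1)
  have hjo : ∀ i j, c (Sum.inr j) (Sum.inr (o i)) ≤ 2 * c (Sum.inl i) (Sum.inr j) := by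
    intro i j
    have e1 := hc_tri (Sum.inr j) (Sum.inl i) (Sum.inr (o i))
    have e2 := hc_symm (Sum.inr j) (Sum.inl i)
    have e3 := ho i j
    linarith
  have hnotown : ∀ i j, o i ≠ j → 2 * Cb j < c (Sum.inl i) (Sum.inr j) := by
    intro i j hij
    have e1 := hfar j (o i) (Ne.symm hij)
    have e2 := hjo i j
    linarith
  have hnotG : ∀ i j, i ∉ G j → ∃ i', o i' ≠ j ∧ c (Sum.inl i') (Sum.inr j) ≤ c (Sum.inl i) (Sum.inr j) := by
    intro i j hi
    by_cases hij : o i = j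
    · rw [hGmem] at hi
      push Not at hi
      obtain ⟨i', h1, h2⟩ := hi hij
      exact ⟨i', h1, h2.le⟩
    · exact ⟨i, hij, le_rfl⟩
  have hout : ∀ i j, i ∉ G j → 2 * Cb j < c (Sum.inl i) (Sum.inr j) := by
    intro i j hi
    obtain ⟨i', h1, h2⟩ := hnotG i j hi
    exact (hnotown i' j h1).trans_le h2
  have hγ : ∀ j, ∃ (g : ℝ) (k : C), (∀ i, i ∉ G j → g ≤ c (Sum.inl i) (Sum.inr j)) ∧
      ((∃ i, o i ≠ j) → k ≠ j ∧ c (Sum.inr j) (Sum.inr k) ≤ 2 * g) := by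
    intro j
    by_cases hH : ∃ i, o i ≠ j
    · obtain ⟨i0, hi0⟩ := hH
      obtain ⟨m, hm, hmin⟩ := Finset.exists_min_image (Finset.univ.filter (fun i => o i ≠ j))
        (fun i => c (Sum.inl i) (Sum.inr j)) ⟨i0, by simp [hi0]⟩
      simp only [Finset.mem_filter, Finset.mem_univ, true_and] at hm hmin
      refine ⟨c (Sum.inl m) (Sum.inr j), o m, ?_, fun _ => ⟨hm, hjo m j⟩⟩
      intro i hi
      obtain ⟨i', h1, h2⟩ := hnotG i j hi
      exact (hmin i' h1).trans h2
    · exact ⟨0, j, fun i _ => hc_nonneg _ _, fun h => absurd h hH⟩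
  choose γ s hγ1 hγ2 using hγ
  have hsplit : ∀ (j : C) (g : F → ℝ), ∑ i ∈ G j, g i + ∑ i ∈ (G j)ᶜ, g i = ∑ i, g i :=
    fun j g => Finset.sum_add_sum_compl (G j) g
  -- the mass of G j
  have hmass : ∀ j, 1 / 2 ≤ ∑ i ∈ G j, x i j := by
    intro j
    by_contra hlt
    push Not at hlt
    have e1 := hsplit j (fun i => x i j)
    rw [hx1 j] at e1
    have hm : 1 / 2 < ∑ i ∈ (G j)ᶜ, x i j := by linarith
    have hCb0 : 0 ≤ Cb j := by
      rw [hCb]; exact Finset.sum_nonneg (fun i _ => mul_nonneg (hc_nonneg _ _) (hx i j))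
    have e2 : ∑ i ∈ (G j)ᶜ, c (Sum.inl i) (Sum.inr j) * x i j ≤ Cb j := by
      rw [hCb, ← hsplit j]
      have := Finset.sum_nonneg (s := G j) (f := fun i => c (Sum.inl i) (Sum.inr j) * x i j)
        (fun i _ => mul_nonneg (hc_nonneg _ _) (hx i j))
      linarith
    obtain ⟨i0, hi0, hpos⟩ : ∃ i ∈ (G j)ᶜ, 0 < x i j := by
      by_contra hcon
      push Not at hcon
      have := Finset.sum_nonpos hcon
      linarith
    have e3 : ∑ i ∈ (G j)ᶜ, 2 * Cb j * x i j < ∑ i ∈ (G j)ᶜ, c (Sum.inl i) (Sum.inr j) * x i j := by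
      apply Finset.sum_lt_sum
      · intro i hi
        exact mul_le_mul_of_nonneg_right (hout i j (by simpa using hi)).le (hx i j)
      · exact ⟨i0, hi0, mul_lt_mul_of_pos_right (hout i0 j (by simpa using hi0)) hpos⟩
    rw [← Finset.mul_sum] at e3
    nlinarith
  have hmass1 : ∀ j, ∑ i ∈ G j, x i j ≤ 1 := by
    intro j
    rw [← hx1 j]
    exact Finset.sum_le_sum_of_subset_of_nonneg (Finset.subset_univ _) (fun i _ _ => hx i j)
  set v : F → ℝ := fun i => if i ∈ G (o i) then x i (o i) else 0 with hv
  have hv0 : ∀ i, 0 ≤ v i := by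
    intro i; simp only [hv]; split_ifs
    · exact hx _ _
    · exact le_rfl
  have hvy : ∀ i, v i ≤ y i := by
    intro i; simp only [hv]; split_ifs
    · exact hxy _ _
    · exact hy _
  have hvG : ∀ j, ∀ i ∈ G j, v i = x i j := by
    intro j i hi
    have hoi := ((hGmem j i).1 hi).1
    subst hoi
    simp [hv, hi]
  have hvsum : ∀ j, ∑ i ∈ G j, v i = ∑ i ∈ G j, x i j := fun j => Finset.sum_congr rfl (hvG j)
  set K : C → F → ℝ := fun j i => if i ∈ G j then c (Sum.inl i) (Sum.inr j) - 2 * γ j else 0 with hK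
  have hKs : ∀ j (v : F → ℝ), ∑ i, K j i * v i =
      ∑ i ∈ G j, c (Sum.inl i) (Sum.inr j) * v i - 2 * γ j * ∑ i ∈ G j, v i := by
    intro j v
    simp [hK, ite_mul, Finset.sum_ite_mem, sub_mul, Finset.sum_sub_distrib, Finset.mul_sum]
  have hlin : ∀ v : F → ℝ, ∑ i, (f i / 2 + ∑ j, d j * K j i) * v i =
      ∑ i, f i / 2 * v i + ∑ j, d j * ∑ i, K j i * v i := by
    intro v
    simp only [add_mul, Finset.sum_add_distrib, Finset.sum_mul, Finset.mul_sum]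
    rw [Finset.sum_comm]
    simp only [mul_assoc]
  obtain ⟨w, hw0, hwρ, hwl, hwu, hwc⟩ := polymatroid_integral
    (fun S => 2 * (matroidRank M S : ℤ))
    (by simp [matroidRank_empty])
    (by
      intro S T
      have : ((matroidRank M (S ∪ T) + matroidRank M (S ∩ T) : ℕ) : ℤ) ≤
        ((matroidRank M S + matroidRank M T : ℕ) : ℤ) := by
        exact_mod_cast matroidRank_submod M S T
      push_cast at this
      linarith)
    G hGd (fun j => if (∃ i, o i ≠ j) then 1 else 2) (fun _ => 2)
    (fun i => f i / 2 + ∑ j, d j * K j i)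
    (fun i => 2 * v i) (fun i => by have := hv0 i; positivity)
    (by
      intro T
      rw [← Finset.mul_sum]
      have e1 := hrank T
      have e2 := Finset.sum_le_sum (s := T) (fun i _ => hvy i)
      push_cast
      linarith)
    (by
      intro j
      rw [← Finset.mul_sum, hvsum]
      split_ifs with hH
      · have := hmass j
        push_cast
        linarith
      · have hu : G j = Finset.univ := by
          ext i
          push Not at hH
          rw [hGmem]
          simp [hH]
        rw [hu, hx1 j]
        norm_num)
    (by
      intro j
      rw [← Finset.mul_sum, hvsum]
      have := hmass1 j
      push_cast
      linarith)
  obtain ⟨Fs, σ, hI, hσ, hcost⟩ := half_to_int c hc_nonneg hc_symm hc_tri f d hd M G hGd γ s w hw0 hwρ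
    (by intro j; have := hwl j; split_ifs at this <;> omega)
    hwu
    (by
      intro j hj
      have := hwl j
      split_ifs at this with hH
      · exact hγ2 j hH
      · omega)
    (by
      intro j k hkj i hi i' hi'
      have h1 := ((hGmem k i).1 hi).2 i'
      apply h1
      rw [((hGmem j i').1 hi').1]
      exact Ne.symm hkj)
  refine ⟨Fs, σ, hI, hσ, hcost.trans ?_⟩
  rw [hlin (fun i => (w i : ℝ)), hlin (fun i => 2 * v i)] at hwc
  have e1 : ∑ i, f i * ((w i : ℝ) / 2) = ∑ i, f i / 2 * (w i : ℝ) :=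
    Finset.sum_congr rfl fun i _ => by ring
  have e2 : ∑ j, d j * (∑ i ∈ G j, c (Sum.inl i) (Sum.inr j) * (w i : ℝ)
          + 2 * γ j * (2 - ∑ i ∈ G j, (w i : ℝ))) =
      ∑ j, d j * (4 * γ j) + ∑ j, d j * ∑ i, K j i * (w i : ℝ) := by
    rw [← Finset.sum_add_distrib]
    refine Finset.sum_congr rfl fun j _ => ?_
    rw [hKs j (fun i => (w i : ℝ))]
    ring
  have e3 : ∑ i, f i / 2 * (2 * v i) ≤ ∑ i, f i * y i := by
    apply Finset.sum_le_sum
    intro i _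
    have := mul_le_mul_of_nonneg_left (hvy i) (hf i)
    linarith
  have e4 : ∑ j, d j * (4 * γ j) + ∑ j, d j * ∑ i, K j i * (2 * v i) ≤ 4 * ∑ j, d j * Cb j := by
    rw [← Finset.sum_add_distrib, Finset.mul_sum]
    apply Finset.sum_le_sum
    intro j _
    rw [← mul_add]
    have : 4 * γ j + ∑ i, K j i * (2 * v i) ≤ 4 * Cb j := by
      rw [hKs j (fun i => 2 * v i), ← Finset.mul_sum, hvsum]
      have q1 : ∑ i ∈ G j, c (Sum.inl i) (Sum.inr j) * (2 * v i) =
          2 * ∑ i ∈ G j, c (Sum.inl i) (Sum.inr j) * x i j := by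
        rw [Finset.mul_sum]
        refine Finset.sum_congr rfl fun i hi => ?_
        rw [hvG j i hi]; ring
      have q2 : γ j * ∑ i ∈ (G j)ᶜ, x i j ≤ ∑ i ∈ (G j)ᶜ, c (Sum.inl i) (Sum.inr j) * x i j := by
        rw [Finset.mul_sum]
        apply Finset.sum_le_sum
        intro i hi
        exact mul_le_mul_of_nonneg_right (hγ1 j i (by simpa using hi)) (hx i j)
      have q3 := hsplit j (fun i => x i j)
      rw [hx1 j] at q3
      have q4 := hsplit j (fun i => c (Sum.inl i) (Sum.inr j) * x i j)
      rw [← hCb j] at q4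
      have q5 : 0 ≤ ∑ i ∈ G j, c (Sum.inl i) (Sum.inr j) * x i j :=
        Finset.sum_nonneg (fun i _ => mul_nonneg (hc_nonneg _ _) (hx i j))
      have q6 : ∑ i ∈ (G j)ᶜ, x i j = 1 - ∑ i ∈ G j, x i j := by linarith
      rw [q6] at q2
      rw [q1]
      nlinarith
    have := mul_le_mul_of_nonneg_left this (hd j)
    linarith
  linarith

/-- Theorem 3.8: any fractional matroid-median solution can be rounded to an
integral solution of cost at most 8 times larger; hence the natural LP
relaxation of matroid median has integrality gap at most 8. -/
theorem matroid_median_integrality_gap_8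
    {F D : Type*} [Fintype F] [Fintype D]
    (c : F ⊕ D → F ⊕ D → ℝ)
    (hc_nonneg : ∀ u v, 0 ≤ c u v)
    (hc_symm : ∀ u v, c u v = c v u)
    (hc_tri : ∀ u v w, c u w ≤ c u v + c v w)
    (f : F → ℝ) (hf : ∀ i, 0 ≤ f i)
    (d : D → ℝ) (hd : ∀ j, 0 ≤ d j)
    (M : Matroid F) (hME : M.E = Set.univ)
    (x : F → D → ℝ) (y : F → ℝ)
    (hx : ∀ i j, 0 ≤ x i j) (hy : ∀ i, 0 ≤ y i)
    (hx1 : ∀ j, 1 ≤ ∑ i, x i j)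
    (hxy : ∀ i j, x i j ≤ y i)
    (hrank : ∀ S : Finset F, ∑ i ∈ S, y i ≤ (matroidRank M S : ℝ)) :
    ∃ (Fs : Finset F) (σ : D → F),
      M.Indep ↑Fs ∧ (∀ j, σ j ∈ Fs) ∧
      (∑ i ∈ Fs, f i) + ∑ j, d j * c (Sum.inl (σ j)) (Sum.inr j) ≤
        8 * ((∑ i, f i * y i) + ∑ j, ∑ i, d j * c (Sum.inl i) (Sum.inr j) * x i j) := by
  -- normalise x
  set X : F → D → ℝ := fun i j => x i j / ∑ k, x k j with hX
  have hpos : ∀ j, 0 < ∑ k, x k j := fun j => lt_of_lt_of_le one_pos (hx1 j)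
  have hX0 : ∀ i j, 0 ≤ X i j := fun i j => div_nonneg (hx i j) (hpos j).le
  have hXx : ∀ i j, X i j ≤ x i j := fun i j => div_le_self (hx i j) (hx1 j)
  have hX1 : ∀ j, ∑ i, X i j = 1 := by
    intro j
    simp only [hX]
    rw [← Finset.sum_div]
    exact div_self (hpos j).ne'
  set Cb : D → ℝ := fun j => ∑ i, c (Sum.inl i) (Sum.inr j) * X i j with hCb
  have hCb0 : ∀ j, 0 ≤ Cb j := fun j =>
    Finset.sum_nonneg (fun i _ => mul_nonneg (hc_nonneg _ _) (hX0 i j))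
  obtain ⟨S, hS1, hS2⟩ := greedy_cluster Cb
    (fun j k => c (Sum.inr j) (Sum.inr k) ≤ 4 * max (Cb j) (Cb k))
    (fun j k h => by rw [hc_symm, max_comm]; exact h)
  have hπ : ∀ j, ∃ k : S, Cb k ≤ Cb j ∧
      ∀ i, c (Sum.inl i) (Sum.inr j) ≤ c (Sum.inl i) (Sum.inr k.1) + 4 * Cb j := by
    intro j
    by_cases hj : j ∈ S
    · exact ⟨⟨j, hj⟩, le_rfl, fun i => by have := hCb0 j; simp only; linarith⟩
    · obtain ⟨k, hk, h1, h2⟩ := hS2 j hj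
      refine ⟨⟨k, hk⟩, h2, fun i => ?_⟩
      rw [max_eq_left h2] at h1
      have e1 := hc_tri (Sum.inl i) (Sum.inr k) (Sum.inr j)
      have e2 := hc_symm (Sum.inr k) (Sum.inr j)
      simp only
      linarith
  choose π hπ1 hπ2 using hπ
  set e : F ⊕ S → F ⊕ D := Sum.map id Subtype.val with he
  set d' : S → ℝ := fun k => ∑ j ∈ Finset.univ.filter (fun j => π j = k), d j with hd'
  have hd'sum : ∀ g : S → ℝ, ∑ k, d' k * g k = ∑ j, d j * g (π j) := by
    intro g
    rw [← Finset.sum_fiberwise (s := Finset.univ) (g := π)]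
    refine Finset.sum_congr rfl fun k _ => ?_
    simp only [hd', Finset.sum_mul]
    refine Finset.sum_congr rfl fun j hj => ?_
    rw [(Finset.mem_filter.1 hj).2]
  obtain ⟨Fs, σ, hI, hσ, hcost⟩ := cluster_round (C := S) (fun u v => c (e u) (e v))
    (fun u v => hc_nonneg _ _) (fun u v => hc_symm _ _) (fun u v w => hc_tri _ _ _)
    f hf d' (fun k => Finset.sum_nonneg (fun j _ => hd j)) M (fun i k => X i k.1) y
    (fun i k => hX0 i k) hy (fun k => hX1 k) (fun i k => (hXx i k).trans (hxy i k)) hrank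
    (fun k => Cb k.1) (fun k => by simp [hCb, he])
    (by
      intro j k hjk
      have := hS1 j j.2 k k.2 (fun h => hjk (Subtype.ext h))
      simp only [not_le] at this
      simp only [he, Sum.map_inr]
      have h' := le_max_left (Cb j) (Cb k)
      linarith)
  simp only [he, Sum.map_inr, Sum.map_inl, id] at hcost
  rw [hd'sum (fun k => c (Sum.inl (σ k)) (Sum.inr k.1)), hd'sum (fun k => Cb k.1)] at hcost
  refine ⟨Fs, fun j => σ (π j), hI, fun j => hσ _, ?_⟩
  have e1 : ∑ j, d j * c (Sum.inl (σ (π j))) (Sum.inr j) ≤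
      ∑ j, d j * c (Sum.inl (σ (π j))) (Sum.inr (π j).1) + 4 * ∑ j, d j * Cb j := by
    rw [Finset.mul_sum, ← Finset.sum_add_distrib]
    apply Finset.sum_le_sum
    intro j _
    have := mul_le_mul_of_nonneg_left (hπ2 j (σ (π j))) (hd j)
    linarith
  have e2 : ∑ j, d j * Cb (π j).1 ≤ ∑ j, d j * Cb j :=
    Finset.sum_le_sum fun j _ => mul_le_mul_of_nonneg_left (hπ1 j) (hd j)
  have e3 : ∑ j, d j * Cb j ≤ ∑ j, ∑ i, d j * c (Sum.inl i) (Sum.inr j) * x i j := by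
    apply Finset.sum_le_sum
    intro j _
    simp only [hCb, Finset.mul_sum]
    apply Finset.sum_le_sum
    intro i _
    rw [← mul_assoc]
    exact mul_le_mul_of_nonneg_left (hXx i j) (mul_nonneg (hd j) (hc_nonneg _ _))
  have e4 : 0 ≤ ∑ i, f i * y i := Finset.sum_nonneg (fun i _ => mul_nonneg (hf i) (hy i))
  linarith
end

section
/- For every matroid median instance and every fractional solution (x,y), there exists an integral solution (F, σ) satisfying the Lagrangian-multiplier-preserving guarantee 8·∑_{i∈F} f_i + ∑_{j∈𝓓} d_j c(σ(j), j) ≤ 8·(∑_i f_i y_i + ∑_j ∑_i d_j c(i,j) x_{ij}). -/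
open scoped Classical
open Finset

lemma mm_half_card {F A : Type*} (a : F → Option A) (E : Finset F)
    (ha : ∀ e ∈ E, a e ≠ none → ∃ e' ∈ E, e' ≠ e ∧ a e' = a e) :
    2 * ((E.filter (fun e => a e ≠ none)).image a).card ≤ (E.filter (fun e => a e ≠ none)).card := by
  apply Finset.mul_card_image_le_card
  intro b hb
  rw [Finset.mem_image] at hb
  obtain ⟨e, he, rfl⟩ := hb
  rw [Finset.mem_filter] at he
  obtain ⟨e', he', hne, heq⟩ := ha e he.1 he.2
  have : 1 < (Finset.filter (fun x => a x = a e) (E.filter (fun e => a e ≠ none))).card := by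
    rw [Finset.one_lt_card]
    refine ⟨e, ?_, e', ?_, hne.symm⟩
    · simp [he]
    · simp only [Finset.mem_filter]
      exact ⟨⟨he', by rw [heq]; exact he.2⟩, heq⟩
  exact this

/-- A nonzero direction, supported on `E`, summing to zero on all fibres of two partial
partitions whose fibres on `E` have at least two elements. -/
lemma mm_exists_dir {F A B : Type*} [Fintype F] (a : F → Option A) (b : F → Option B)
    (E : Finset F) (hE : E.Nonempty)
    (ha : ∀ e ∈ E, a e ≠ none → ∃ e' ∈ E, e' ≠ e ∧ a e' = a e)
    (hb : ∀ e ∈ E, b e ≠ none → ∃ e' ∈ E, e' ≠ e ∧ b e' = b e) :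
    ∃ d : F → ℝ, d ≠ 0 ∧ (∀ e, e ∉ E → d e = 0) ∧
      (∀ α, ∑ e ∈ univ.filter (fun e => a e = some α), d e = 0) ∧
      (∀ β, ∑ e ∈ univ.filter (fun e => b e = some β), d e = 0) := by
  set pa := (E.filter (fun e => a e ≠ none)).image a with hpa
  set pb := (E.filter (fun e => b e ≠ none)).image b with hpb
  have h2a := mm_half_card a E ha
  have h2b := mm_half_card b E hb
  rw [← hpa] at h2a
  rw [← hpb] at h2b
  have hca : (E.filter (fun e => a e ≠ none)).card ≤ E.card := Finset.card_filter_le _ _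
  have hcb : (E.filter (fun e => b e ≠ none)).card ≤ E.card := Finset.card_filter_le _ _
  have hE0 : 0 < E.card := hE.card_pos
  let L : (F → ℝ) →ₗ[ℝ] (pa → ℝ) × (pb → ℝ) × ({e // e ∉ E} → ℝ) :=
    { toFun := fun w => (fun α => ∑ e ∈ E.filter (fun e => a e = α), w e,
        fun β => ∑ e ∈ E.filter (fun e => b e = β), w e, fun e => w e)
      map_add' := by
        intro w w'
        ext <;> simp [Finset.sum_add_distrib]
      map_smul' := by
        intro r w
        ext <;> simp [Finset.mul_sum] }
  have hcomp : Fintype.card {e // e ∉ E} + E.card = Fintype.card F := by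
    rw [Fintype.card_subtype_compl]
    simp only [Fintype.card_coe]
    have := Finset.card_le_univ E
    omega
  have hfr : Module.finrank ℝ ((pa → ℝ) × (pb → ℝ) × ({e // e ∉ E} → ℝ))
      = pa.card + (pb.card + Fintype.card {e // e ∉ E}) := by
    rw [Module.finrank_prod, Module.finrank_prod]
    simp only [Module.finrank_fintype_fun_eq_card, Fintype.card_coe]
  have hninj : ¬ Function.Injective L := by
    intro hinj
    have h1 := LinearMap.finrank_le_finrank_of_injective hinj
    rw [hfr, Module.finrank_fintype_fun_eq_card] at h1
    have hsurj : Function.Surjective L := by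
      rw [← LinearMap.injective_iff_surjective_of_finrank_eq_finrank]
      · exact hinj
      · rw [hfr, Module.finrank_fintype_fun_eq_card]
        omega
    have hEa : E.filter (fun e => a e ≠ none) = E :=
      Finset.eq_of_subset_of_card_le (Finset.filter_subset _ _) (by omega)
    have hEb : E.filter (fun e => b e ≠ none) = E :=
      Finset.eq_of_subset_of_card_le (Finset.filter_subset _ _) (by omega)
    have hpa0 : pa.Nonempty := by
      rw [← Finset.card_pos]; omega
    obtain ⟨w, hw⟩ := hsurj (fun _ => 1, 0, 0)
    have hw1 : ∀ α ∈ pa, ∑ e ∈ E.filter (fun e => a e = α), w e = 1 := by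
      intro α hα
      have := congrFun (congrArg Prod.fst hw) ⟨α, hα⟩
      simpa [L] using this
    have hw2 : ∀ β ∈ pb, ∑ e ∈ E.filter (fun e => b e = β), w e = 0 := by
      intro β hβ
      have := congrFun (congrArg (fun z => z.2.1) hw) ⟨β, hβ⟩
      simpa [L] using this
    have s1 : ∑ e ∈ E, w e = ∑ α ∈ pa, 1 := by
      rw [← Finset.sum_congr rfl hw1]
      rw [Finset.sum_fiberwise_of_maps_to]
      intro e he
      rw [hpa, hEa]
      exact Finset.mem_image_of_mem _ he
    have s2 : ∑ e ∈ E, w e = ∑ β ∈ pb, 0 := by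
      rw [← Finset.sum_congr rfl hw2]
      rw [Finset.sum_fiberwise_of_maps_to]
      intro e he
      rw [hpb, hEb]
      exact Finset.mem_image_of_mem _ he
    rw [s1] at s2
    simp at s2
    simp [s2] at hpa0
  have : ∃ d, L d = 0 ∧ d ≠ 0 := by
    by_contra hcon
    push Not at hcon
    exact hninj ((injective_iff_map_eq_zero L).2 hcon)
  obtain ⟨d, hd, hd0⟩ := this
  have hout : ∀ e, e ∉ E → d e = 0 := by
    intro e he
    have := congrFun (congrArg (fun z => z.2.2) hd) ⟨e, he⟩
    simpa [L] using this
  refine ⟨d, hd0, hout, ?_, ?_⟩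
  · intro α
    have e1 : ∑ e ∈ univ.filter (fun e => a e = some α), d e
        = ∑ e ∈ E.filter (fun e => a e = some α), d e := by
      symm
      apply Finset.sum_subset (Finset.filter_subset_filter _ (Finset.subset_univ _))
      intro e he hne
      apply hout
      intro h
      exact hne (Finset.mem_filter.2 ⟨h, (Finset.mem_filter.1 he).2⟩)
    rw [e1]
    by_cases hα : some α ∈ pa
    · have := congrFun (congrArg Prod.fst hd) ⟨some α, hα⟩
      simpa [L] using this
    · rw [Finset.sum_eq_zero]
      intro e he
      rw [Finset.mem_filter] at he
      exfalso
      apply hα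
      rw [hpa, Finset.mem_image]
      exact ⟨e, Finset.mem_filter.2 ⟨he.1, by rw [he.2]; simp⟩, he.2⟩
  · intro α
    have e1 : ∑ e ∈ univ.filter (fun e => b e = some α), d e
        = ∑ e ∈ E.filter (fun e => b e = some α), d e := by
      symm
      apply Finset.sum_subset (Finset.filter_subset_filter _ (Finset.subset_univ _))
      intro e he hne
      apply hout
      intro h
      exact hne (Finset.mem_filter.2 ⟨h, (Finset.mem_filter.1 he).2⟩)
    rw [e1]
    by_cases hα : some α ∈ pb
    · have := congrFun (congrArg (fun z => z.2.1) hd) ⟨some α, hα⟩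
      simpa [L] using this
    · rw [Finset.sum_eq_zero]
      intro e he
      rw [Finset.mem_filter] at he
      exfalso
      apply hα
      rw [hpb, Finset.mem_image]
      exact ⟨e, Finset.mem_filter.2 ⟨he.1, by rw [he.2]; simp⟩, he.2⟩

/-- integrality of a real number -/
def mmInt (r : ℝ) : Prop := ∃ n : ℤ, r = n

lemma mmInt.sub {r s : ℝ} (hr : mmInt r) (hs : mmInt s) : mmInt (r - s) := by
  obtain ⟨n, rfl⟩ := hr
  obtain ⟨m, rfl⟩ := hs
  exact ⟨n - m, by push_cast; rfl⟩

lemma mmInt_sum {F : Type*} (S : Finset F) (u : F → ℝ) (h : ∀ e ∈ S, mmInt (u e)) :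
    mmInt (∑ e ∈ S, u e) := by
  induction S using Finset.induction_on with
  | empty => exact ⟨0, by simp⟩
  | insert a S ha ih =>
    rw [Finset.sum_insert ha]
    obtain ⟨n, hn⟩ := h a (Finset.mem_insert_self _ _)
    obtain ⟨m, hm⟩ := ih (fun e he => h e (Finset.mem_insert_of_mem he))
    exact ⟨n + m, by rw [hn, hm]; push_cast; rfl⟩

lemma mm_two_frac {F : Type*} (S : Finset F) (u : F → ℝ) (hS : mmInt (∑ e ∈ S, u e))
    (e : F) (he : e ∈ S) (hne : ¬ mmInt (u e)) :
    ∃ e' ∈ S, e' ≠ e ∧ ¬ mmInt (u e') := by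
  by_contra hcon
  push Not at hcon
  apply hne
  have h1 : u e = ∑ e ∈ S, u e - ∑ e' ∈ S.erase e, u e' := by
    rw [← Finset.add_sum_erase S u he]; ring
  rw [h1]
  apply hS.sub
  apply mmInt_sum
  intro e' he'
  rw [Finset.mem_erase] at he'
  exact hcon e' he'.2 he'.1

/-- From a lattice of sets with integral sums, a partial partition with integral fibres
refining every member. -/
lemma mm_lattice {F : Type*} [Fintype F] (T : Finset F → Prop) (u : F → ℝ)
    (h0 : T ∅) (hU : ∀ X Y, T X → T Y → T (X ∪ Y)) (hI : ∀ X Y, T X → T Y → T (X ∩ Y))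
    (hint : ∀ X, T X → mmInt (∑ e ∈ X, u e)) :
    ∃ a : F → Option (Finset F),
      (∀ X, mmInt (∑ e ∈ univ.filter (fun e => a e = some X), u e)) ∧
      (∀ d : F → ℝ, (∀ X, ∑ e ∈ univ.filter (fun e => a e = some X), d e = 0) →
        ∀ X, T X → ∑ e ∈ X, d e = 0) := by
  have hcl : ∀ e, (∃ X, T X ∧ e ∈ X) → ∃ C, T C ∧ e ∈ C ∧ ∀ X, T X → e ∈ X → C ⊆ X := by
    intro e ⟨X, hX, heX⟩
    obtain ⟨C, hC, hmin⟩ := Finset.exists_min_image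
      (univ.filter (fun X : Finset F => T X ∧ e ∈ X)) Finset.card ⟨X, by simp [hX, heX]⟩
    simp only [Finset.mem_filter, Finset.mem_univ, true_and] at hC hmin
    refine ⟨C, hC.1, hC.2, ?_⟩
    intro Y hY heY
    have := hmin (C ∩ Y) ⟨hI _ _ hC.1 hY, Finset.mem_inter.2 ⟨hC.2, heY⟩⟩
    have h2 := Finset.eq_of_subset_of_card_le Finset.inter_subset_left this
    rw [← h2]; exact Finset.inter_subset_right
  choose! cl hclT hcle hclmin using hcl
  refine ⟨fun e => if (∃ X, T X ∧ e ∈ X) then some (cl e) else none, ?_, ?_⟩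
  · intro X
    by_cases hne : ∃ e, (∃ X, T X ∧ e ∈ X) ∧ cl e = X
    · obtain ⟨e, he, rfl⟩ := hne
      set Y := (cl e).filter (fun e' => cl e' ≠ cl e) with hY
      have hcov : ∀ e' ∈ cl e, ∃ X, T X ∧ e' ∈ X := fun e' he' => ⟨cl e, hclT e he, he'⟩
      have hsub : ∀ e' ∈ cl e, cl e' ⊆ cl e := fun e' he' =>
        hclmin e' (hcov e' he') _ (hclT e he) he'
      have hYT : T Y := by
        have : Y = Y.sup cl := by
          ext z
          rw [Finset.mem_sup]
          constructor
          · intro hz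
            exact ⟨z, hz, hcle z (hcov z (Finset.mem_filter.1 hz).1)⟩
          · rintro ⟨v, hv, hz⟩
            rw [hY, Finset.mem_filter] at hv ⊢
            have hzc := hsub v hv.1 hz
            refine ⟨hzc, ?_⟩
            intro heq
            apply hv.2
            apply Finset.Subset.antisymm (hsub v hv.1)
            rw [← heq]
            exact hclmin z (hcov z hzc) _ (hclT v (hcov v hv.1)) hz
        rw [this]
        apply Finset.sup_induction (p := T)
        · exact h0
        · intro a ha b hb; exact hU a b ha hb
        · intro b hb; exact hclT b (hcov b (Finset.mem_filter.1 hb).1)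
      have hfib : univ.filter (fun e' => (if (∃ X, T X ∧ e' ∈ X) then some (cl e') else none)
          = some (cl e)) = (cl e).filter (fun e' => ¬ (cl e' ≠ cl e)) := by
        ext z
        simp only [Finset.mem_filter, Finset.mem_univ, true_and, not_not]
        constructor
        · intro hz
          split_ifs at hz with h
          rw [Option.some_inj] at hz
          exact ⟨hz ▸ hcle z h, hz⟩
        · rintro ⟨hz, hz2⟩
          rw [if_pos (hcov z hz), hz2]
      rw [hfib]
      have hs := Finset.sum_filter_add_sum_filter_not (cl e) (fun e' => cl e' ≠ cl e) u
      have : ∑ x ∈ (cl e).filter (fun e' => ¬ (cl e' ≠ cl e)), u x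
          = ∑ x ∈ cl e, u x - ∑ x ∈ Y, u x := by rw [← hs, hY]; ring
      rw [this]
      exact (hint _ (hclT e he)).sub (hint _ hYT)
    · rw [Finset.filter_false_of_mem]
      · exact ⟨0, by simp⟩
      · intro e _ hh
        beta_reduce at hh
        split_ifs at hh with h
        rw [Option.some_inj] at hh
        exact hne ⟨e, h, hh⟩
  · intro d hd X hX
    have hcov : ∀ e' ∈ X, ∃ X, T X ∧ e' ∈ X := fun e' he' => ⟨X, hX, he'⟩
    rw [← Finset.sum_fiberwise_of_maps_to (g := cl) (t := X.image cl)
      (fun i hi => Finset.mem_image_of_mem _ hi)]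
    apply Finset.sum_eq_zero
    intro C hC
    rw [Finset.mem_image] at hC
    obtain ⟨e, he, rfl⟩ := hC
    rw [← hd (cl e)]
    apply Finset.sum_congr _ (fun _ _ => rfl)
    ext z
    simp only [Finset.mem_filter, Finset.mem_univ, true_and]
    constructor
    · rintro ⟨hz, hz2⟩
      rw [if_pos (hcov z hz), hz2]
    · intro hz
      split_ifs at hz with h
      rw [Option.some_inj] at hz
      exact ⟨hclmin e (hcov e he) X hX he (hz ▸ hcle z h), hz⟩

/-- The feasible polytope. -/
def mmPoly {F ι : Type*} (ρ : Finset F → ℕ) (s : Finset ι) (P G : ι → Finset F) (h : ℕ) :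
    Set (F → ℝ) :=
  {u | (∀ e, 0 ≤ u e) ∧ (∀ S : Finset F, ∑ e ∈ S, u e ≤ (ρ S : ℝ)) ∧
    (∀ j ∈ s, 1 ≤ ∑ e ∈ P j, u e) ∧ (∀ j ∈ s, ∑ e ∈ G j, u e ≤ (h : ℝ))}

lemma mmPoly_compact {F ι : Type*} [Fintype F] (ρ : Finset F → ℕ) (s : Finset ι)
    (P G : ι → Finset F) (h : ℕ) : IsCompact (mmPoly ρ s P G h) := by
  apply IsCompact.of_isClosed_subset (s := Set.Icc (0 : F → ℝ) (fun e => (ρ {e} : ℝ)))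
  · exact isCompact_Icc
  · unfold mmPoly
    simp only [Set.ofPred_and, Set.ofPred_forall]
    refine IsClosed.inter ?_ (IsClosed.inter ?_ (IsClosed.inter ?_ ?_))
    · exact isClosed_iInter fun e => isClosed_le (by fun_prop) (by fun_prop)
    · exact isClosed_iInter fun e => isClosed_le (by fun_prop) (by fun_prop)
    · exact isClosed_iInter fun e => isClosed_iInter fun _ => isClosed_le (by fun_prop) (by fun_prop)
    · exact isClosed_iInter fun e => isClosed_iInter fun _ => isClosed_le (by fun_prop) (by fun_prop)
  · intro u hu
    refine ⟨fun e => hu.1 e, fun e => ?_⟩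
    have := hu.2.1 {e}
    simpa using this

lemma mm_ev (p q r : ℝ) (hp : p ≤ r) (hq : p = r → q = 0) :
    ∀ᶠ t : ℝ in nhds 0, p + t * q ≤ r := by
  rcases hp.eq_or_lt with h | h
  · rw [hq h]; simp [h]
  · have : Filter.Tendsto (fun t : ℝ => p + t * q) (nhds 0) (nhds (p + 0 * q)) :=
      Continuous.tendsto (by fun_prop) 0
    rw [zero_mul, add_zero] at this
    exact (this.eventually_lt_const h).mono fun _ h => h.le

lemma mm_perturb {F ι : Type*} [Fintype F] (ρ : Finset F → ℕ) (s : Finset ι)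
    (P G : ι → Finset F) (h : ℕ) (u d : F → ℝ) (hu : u ∈ mmPoly ρ s P G h)
    (h1 : ∀ e, u e = 0 → d e = 0)
    (h2 : ∀ S : Finset F, ∑ e ∈ S, u e = (ρ S : ℝ) → ∑ e ∈ S, d e = 0)
    (h3 : ∀ j ∈ s, ∑ e ∈ P j, u e = 1 → ∑ e ∈ P j, d e = 0)
    (h4 : ∀ j ∈ s, ∑ e ∈ G j, u e = (h : ℝ) → ∑ e ∈ G j, d e = 0) :
    ∀ᶠ t : ℝ in nhds 0, (fun e => u e + t * d e) ∈ mmPoly ρ s P G h := by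
  have hsum : ∀ (t : ℝ) (S : Finset F), ∑ e ∈ S, (u e + t * d e)
      = ∑ e ∈ S, u e + t * ∑ e ∈ S, d e := by
    intro t S
    rw [Finset.sum_add_distrib, Finset.mul_sum]
  unfold mmPoly
  simp only [Set.mem_ofPred_eq, hsum]
  refine Filter.Eventually.and ?_ (Filter.Eventually.and ?_ (Filter.Eventually.and ?_ ?_))
  · rw [Filter.eventually_all]
    intro e
    refine (mm_ev (- u e) (- d e) 0 (by linarith [hu.1 e]) ?_).mono ?_
    · intro h; rw [h1 e (by linarith)]; simp
    · intro t ht; linarith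
  · rw [Filter.eventually_all]
    intro S
    exact mm_ev _ _ _ (hu.2.1 S) (h2 S)
  · rw [Filter.eventually_all_finset]
    intro j hj
    refine (mm_ev (- ∑ e ∈ P j, u e) (- ∑ e ∈ P j, d e) (-1) (by linarith [hu.2.2.1 j hj]) ?_).mono ?_
    · intro h; rw [h3 j hj (by linarith)]; simp
    · intro t ht; linarith
  · rw [Filter.eventually_all_finset]
    intro j hj
    exact mm_ev _ _ _ (hu.2.2.2 j hj) (h4 j hj)

/-- If `u` is in the polytope with a nonintegral coordinate there is a perturbation direction. -/
lemma mm_dir_of_frac {F ι : Type*} [Fintype F] (ρ : Finset F → ℕ) (hρ0 : ρ ∅ = 0)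
    (hsub : ∀ S T, ρ (S ∪ T) + ρ (S ∩ T) ≤ ρ S + ρ T) (s : Finset ι)
    (P G : ι → Finset F) (h : ℕ) (hPG : ∀ j ∈ s, P j ⊆ G j)
    (hdisj : ∀ j ∈ s, ∀ k ∈ s, j ≠ k → Disjoint (G j) (G k))
    (u : F → ℝ) (hu : u ∈ mmPoly ρ s P G h) (hfrac : ∃ e, ¬ mmInt (u e)) :
    ∃ d : F → ℝ, d ≠ 0 ∧ ∀ᶠ t : ℝ in nhds 0, (fun e => u e + t * d e) ∈ mmPoly ρ s P G h := by
  have htight : ∀ X Y : Finset F, ∑ e ∈ X, u e = (ρ X : ℝ) → ∑ e ∈ Y, u e = (ρ Y : ℝ) →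
      ∑ e ∈ X ∪ Y, u e = (ρ (X ∪ Y) : ℝ) ∧ ∑ e ∈ X ∩ Y, u e = (ρ (X ∩ Y) : ℝ) := by
    intro X Y hX hY
    have h1 := Finset.sum_union_inter (s₁ := X) (s₂ := Y) (f := u)
    have h2 : ((ρ (X ∪ Y) : ℝ)) + ρ (X ∩ Y) ≤ ρ X + ρ Y := by exact_mod_cast hsub X Y
    have h3 := hu.2.1 (X ∪ Y)
    have h4 := hu.2.1 (X ∩ Y)
    constructor <;> linarith
  obtain ⟨a, ha1, ha2⟩ := mm_lattice (fun X => ∑ e ∈ X, u e = (ρ X : ℝ)) u (by simp [hρ0])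
    (fun X Y hX hY => (htight X Y hX hY).1) (fun X Y hX hY => (htight X Y hX hY).2)
    (fun X hX => ⟨ρ X, by rw [hX]; simp⟩)
  have hb : ∃ b : F → Option (ι × Bool),
      (∀ X, mmInt (∑ e ∈ univ.filter (fun e => b e = some X), u e)) ∧
      (∀ d : F → ℝ, (∀ X, ∑ e ∈ univ.filter (fun e => b e = some X), d e = 0) →
        (∀ j ∈ s, ∑ e ∈ P j, u e = 1 → ∑ e ∈ P j, d e = 0) ∧
        (∀ j ∈ s, ∑ e ∈ G j, u e = (h : ℝ) → ∑ e ∈ G j, d e = 0)) := by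
    have huniq : ∀ j ∈ s, ∀ k ∈ s, ∀ e, e ∈ G j → e ∈ G k → j = k := by
      intro j hj k hk e he he'
      by_contra hne
      exact Finset.disjoint_left.1 (hdisj j hj k hk hne) he he'
    let b : F → Option (ι × Bool) := fun e =>
      if hp : ∃ j, j ∈ s ∧ e ∈ P j ∧ ∑ e ∈ P j, u e = 1 then some (hp.choose, false)
      else if hg : ∃ j, j ∈ s ∧ e ∈ G j ∧ ∑ e ∈ G j, u e = (h : ℝ) then some (hg.choose, true)
      else none
    have hbf : ∀ e j, b e = some (j, false) ↔ (j ∈ s ∧ e ∈ P j ∧ ∑ e ∈ P j, u e = 1) := by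
      intro e j
      simp only [b]
      split_ifs with hp hg
      · have := hp.choose_spec
        constructor
        · intro hh
          simp only [Option.some_inj, Prod.mk.injEq, and_true] at hh
          rw [← hh]; exact this
        · intro hh
          rw [huniq _ this.1 j hh.1 e (hPG _ this.1 this.2.1) (hPG _ hh.1 hh.2.1)]
      · simp only [Option.some_inj, Prod.mk.injEq, Bool.true_eq_false, and_false, false_iff]
        exact fun hh => hp ⟨j, hh⟩
      · simp only [false_iff]
        exact fun hh => hp ⟨j, hh⟩
    have hbt : ∀ e j, b e = some (j, true) ↔ (j ∈ s ∧ e ∈ G j ∧ ∑ e ∈ G j, u e = (h : ℝ)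
        ∧ ¬ (e ∈ P j ∧ ∑ e ∈ P j, u e = 1)) := by
      intro e j
      simp only [b]
      split_ifs with hp hg
      · have := hp.choose_spec
        simp only [Option.some_inj, Prod.mk.injEq, Bool.false_eq_true, and_false, false_iff]
        intro hh
        have heq := huniq _ this.1 j hh.1 e (hPG _ this.1 this.2.1) hh.2.1
        rw [heq] at this
        exact hh.2.2.2 this.2
      · have := hg.choose_spec
        constructor
        · intro hh
          simp only [Option.some_inj, Prod.mk.injEq, and_true] at hh
          rw [← hh]
          exact ⟨this.1, this.2.1, this.2.2, fun hc => hp ⟨_, this.1, hc⟩⟩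
        · intro hh
          rw [huniq _ this.1 j hh.1 e this.2.1 hh.2.1]
      · simp only [false_iff]
        exact fun hh => hg ⟨j, hh.1, hh.2.1, hh.2.2.1⟩
    have key1 : ∀ j ∈ s, ∑ e ∈ P j, u e = 1 →
        univ.filter (fun e => b e = some (j, false)) = P j := by
      intro j hj hP
      ext e
      simp [hbf, hj, hP]
    have key2 : ∀ j ∈ s, ∑ e ∈ G j, u e = (h : ℝ) → ∑ e ∈ P j, u e = 1 →
        univ.filter (fun e => b e = some (j, true)) = G j \ P j := by
      intro j hj hP hG
      ext e
      simp [hbt, hj, hP, hG]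
    have key3 : ∀ j ∈ s, ∑ e ∈ G j, u e = (h : ℝ) → ¬ ∑ e ∈ P j, u e = 1 →
        univ.filter (fun e => b e = some (j, true)) = G j := by
      intro j hj hP hG
      ext e
      simp [hbt, hj, hP, hG]
    refine ⟨b, ?_, ?_⟩
    · rintro ⟨j, _ | _⟩
      · by_cases hc : j ∈ s ∧ ∑ e ∈ P j, u e = 1
        · rw [key1 j hc.1 hc.2, hc.2]; exact ⟨1, by simp⟩
        · rw [Finset.filter_false_of_mem]
          · exact ⟨0, by simp⟩
          · intro e _ he
            rw [hbf] at he
            exact hc ⟨he.1, he.2.2⟩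
      · by_cases hc : j ∈ s ∧ ∑ e ∈ G j, u e = (h : ℝ)
        · by_cases hP : ∑ e ∈ P j, u e = 1
          · rw [key2 j hc.1 hc.2 hP, Finset.sum_sdiff_eq_sub (hPG j hc.1), hc.2, hP]
            exact ⟨h - 1, by simp⟩
          · rw [key3 j hc.1 hc.2 hP, hc.2]
            exact ⟨h, by simp⟩
        · rw [Finset.filter_false_of_mem]
          · exact ⟨0, by simp⟩
          · intro e _ he
            rw [hbt] at he
            exact hc ⟨he.1, he.2.2.1⟩
    · intro d hd
      have hPd : ∀ j ∈ s, ∑ e ∈ P j, u e = 1 → ∑ e ∈ P j, d e = 0 := by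
        intro j hj hP
        rw [← key1 j hj hP]; exact hd _
      refine ⟨hPd, ?_⟩
      intro j hj hG
      have h5 := hd (j, true)
      by_cases hP : ∑ e ∈ P j, u e = 1
      · rw [key2 j hj hG hP, Finset.sum_sdiff_eq_sub (hPG j hj), hPd j hj hP] at h5
        linarith
      · rw [key3 j hj hG hP] at h5
        exact h5
  obtain ⟨b, hb1, hb2⟩ := hb
  obtain ⟨e0, he0⟩ := hfrac
  obtain ⟨d, hd0, hdE, hda, hdb⟩ := mm_exists_dir a b (univ.filter fun e => ¬ mmInt (u e))
    ⟨e0, by simp [he0]⟩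
    (by
      intro e he hne
      obtain ⟨X, hX⟩ := Option.ne_none_iff_exists'.1 hne
      obtain ⟨e', h1, h2, h3⟩ := mm_two_frac _ u (ha1 X) e (by simp [hX]) (Finset.mem_filter.1 he).2
      exact ⟨e', by simp [h3], h2, by rw [(Finset.mem_filter.1 h1).2, hX]⟩)
    (by
      intro e he hne
      obtain ⟨X, hX⟩ := Option.ne_none_iff_exists'.1 hne
      obtain ⟨e', h1, h2, h3⟩ := mm_two_frac _ u (hb1 X) e (by simp [hX]) (Finset.mem_filter.1 he).2
      exact ⟨e', by simp [h3], h2, by rw [(Finset.mem_filter.1 h1).2, hX]⟩)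
  have hda' := ha2 d (by intro X; convert hda X)
  have hdb' := hb2 d (by intro X; convert hdb X)
  refine ⟨d, hd0, mm_perturb ρ s P G h u d hu ?_ hda' hdb'.1 hdb'.2⟩
  intro e he
  apply hdE
  simp only [Finset.mem_filter, Finset.mem_univ, true_and, not_not]
  exact ⟨0, by simp [he]⟩

/-- Integral rounding. -/
lemma mm_round {F ι : Type*} [Fintype F] (ρ : Finset F → ℕ) (hρ0 : ρ ∅ = 0)
    (hsub : ∀ S T, ρ (S ∪ T) + ρ (S ∩ T) ≤ ρ S + ρ T) (s : Finset ι)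
    (P G : ι → Finset F) (h : ℕ) (hPG : ∀ j ∈ s, P j ⊆ G j)
    (hdisj : ∀ j ∈ s, ∀ k ∈ s, j ≠ k → Disjoint (G j) (G k))
    (w v : F → ℝ) (hv0 : ∀ e, 0 ≤ v e) (hvρ : ∀ S : Finset F, ∑ e ∈ S, v e ≤ (ρ S : ℝ))
    (hvP : ∀ j ∈ s, 1 ≤ ∑ e ∈ P j, v e) (hvG : ∀ j ∈ s, ∑ e ∈ G j, v e ≤ (h : ℝ)) :
    ∃ u : F → ℕ, (∀ S : Finset F, ∑ e ∈ S, u e ≤ ρ S) ∧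
      (∀ j ∈ s, 1 ≤ ∑ e ∈ P j, u e) ∧ (∀ j ∈ s, ∑ e ∈ G j, u e ≤ h) ∧
      ∑ e, w e * (u e : ℝ) ≤ ∑ e, w e * v e := by
  have hv : v ∈ mmPoly ρ s P G h := ⟨hv0, hvρ, hvP, hvG⟩
  have hcont : Continuous (fun u : F → ℝ => ∑ e, w e * u e) := by fun_prop
  obtain ⟨u0, hu0, hmin⟩ := (mmPoly_compact ρ s P G h).exists_isMinOn ⟨v, hv⟩ hcont.continuousOn
  have hmin' : ∀ z ∈ mmPoly ρ s P G h, ∑ e, w e * u0 e ≤ ∑ e, w e * z e := hmin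
  set A := mmPoly ρ s P G h ∩ {u | ∑ e, w e * u e = ∑ e, w e * u0 e} with hA
  have hAc : IsCompact A :=
    (mmPoly_compact ρ s P G h).inter_right (isClosed_eq hcont continuous_const)
  obtain ⟨u, hu⟩ := hAc.extremePoints_nonempty ⟨u0, hu0, rfl⟩
  rw [mem_extremePoints] at hu
  obtain ⟨⟨huP, huw⟩, hext⟩ := hu
  have hint : ∀ e, mmInt (u e) := by
    by_contra hcon
    push Not at hcon
    obtain ⟨d, hd0, hd⟩ := mm_dir_of_frac ρ hρ0 hsub s P G h hPG hdisj u huP hcon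
    rw [Metric.eventually_nhds_iff] at hd
    obtain ⟨ε, hε, hd⟩ := hd
    have hp := hd (y := ε / 2) (by simp [abs_of_pos hε]; linarith)
    have hm := hd (y := -(ε / 2)) (by simp [abs_of_pos hε]; linarith)
    have hsum : ∀ t : ℝ, ∑ e, w e * (u e + t * d e) = ∑ e, w e * u e + t * ∑ e, w e * d e := by
      intro t
      rw [Finset.mul_sum, ← Finset.sum_add_distrib]
      exact Finset.sum_congr rfl fun e _ => by ring
    have hp' := hmin' _ hp
    have hm' := hmin' _ hm
    rw [hsum] at hp' hm'
    have huw' : ∑ e, w e * u e = ∑ e, w e * u0 e := huw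
    have hz : ε / 2 * ∑ e, w e * d e = 0 := by linarith
    have h1 := hext _ ⟨hp, by show _ = _; rw [hsum, hz, huw', add_zero]⟩ _
      ⟨hm, by show _ = _; rw [hsum, neg_mul, hz, huw']; simp⟩
      ⟨1 / 2, 1 / 2, by norm_num, by norm_num, by norm_num, by
        ext e; simp; ring⟩
    apply hd0
    ext e
    have := congrFun h1.1 e
    simp only [add_eq_left, mul_eq_zero] at this
    rcases this with h | h
    · linarith
    · exact h
  have hnat : ∀ e, ∃ n : ℕ, u e = n := by
    intro e
    obtain ⟨n, hn⟩ := hint e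
    have : 0 ≤ n := by
      have := huP.1 e
      rw [hn] at this
      exact_mod_cast this
    exact ⟨n.toNat, by rw [hn]; exact_mod_cast (Int.toNat_of_nonneg this).symm⟩
  choose un hun using hnat
  refine ⟨un, ?_, ?_, ?_, ?_⟩
  · intro S
    have := huP.2.1 S
    simp only [hun] at this
    exact_mod_cast this
  · intro j hj
    have := huP.2.2.1 j hj
    simp only [hun] at this
    exact_mod_cast this
  · intro j hj
    have := huP.2.2.2 j hj
    simp only [hun] at this
    exact_mod_cast this
  · have := hmin' v hv
    have h2 : ∑ e, w e * u e = ∑ e, w e * u0 e := huw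
    simp only [hun] at h2
    linarith

lemma mm_rank_eq {F : Type*} [Fintype F] (M : Matroid F) (hME : M.E = Set.univ) (S : Finset F) :
    (matroidRank M S : ℕ∞) = M.eRk (S : Set F) := by
  unfold matroidRank
  apply le_antisymm
  · have hne : (S.powerset.filter (fun I : Finset F => M.Indep ↑I)).Nonempty :=
      ⟨∅, by simp⟩
    obtain ⟨I, hI, hIc⟩ := Finset.exists_mem_eq_sup _ hne Finset.card
    rw [hIc]
    rw [Finset.mem_filter, Finset.mem_powerset] at hI
    have := hI.2.encard_le_eRk_of_subset (X := (S : Set F)) (by exact_mod_cast hI.1)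
    rwa [Set.encard_coe_eq_coe_finsetCard] at this
  · obtain ⟨I, hI⟩ := M.exists_isBasis (S : Set F) (by rw [hME]; exact Set.subset_univ _)
    rw [← hI.encard_eq_eRk]
    have hfin : I.Finite := Set.toFinite I
    have h1 : I.encard = (hfin.toFinset.card : ℕ∞) := by
      rw [← Set.encard_coe_eq_coe_finsetCard]; simp
    rw [h1]
    have : hfin.toFinset.card ≤ (S.powerset.filter (fun I : Finset F => M.Indep ↑I)).sup Finset.card := by
      apply Finset.le_sup (f := Finset.card)
      rw [Finset.mem_filter, Finset.mem_powerset]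
      refine ⟨?_, by simpa using hI.indep⟩
      intro e he
      have := hI.subset (hfin.mem_toFinset.1 he)
      exact_mod_cast this
    exact_mod_cast this

lemma mm_rank_sub {F : Type*} [Fintype F] (M : Matroid F) (hME : M.E = Set.univ)
    (S T : Finset F) :
    matroidRank M (S ∪ T) + matroidRank M (S ∩ T) ≤ matroidRank M S + matroidRank M T := by
  have := M.eRk_submod (S : Set F) (T : Set F)
  rw [← Finset.coe_inter, ← Finset.coe_union] at this
  simp only [← mm_rank_eq M hME] at this
  have h2 : matroidRank M (S ∩ T) + matroidRank M (S ∪ T) ≤ matroidRank M S + matroidRank M T := by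
    exact_mod_cast this
  omega

lemma mm_rank_empty {F : Type*} (M : Matroid F) : matroidRank M ∅ = 0 := by
  unfold matroidRank
  rw [← Nat.le_zero]
  apply Finset.sup_le
  intro I hI
  simp at hI
  simp [hI]

lemma mm_indep {F : Type*} (M : Matroid F) (S : Finset F) (h : S.card ≤ matroidRank M S) :
    M.Indep (S : Set F) := by
  unfold matroidRank at h
  have hne : (S.powerset.filter (fun I : Finset F => M.Indep ↑I)).Nonempty :=
    ⟨∅, by simp⟩
  obtain ⟨I, hI, hIc⟩ := Finset.exists_mem_eq_sup _ hne Finset.card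
  rw [Finset.mem_filter, Finset.mem_powerset] at hI
  rw [hIc] at h
  rw [← Finset.eq_of_subset_of_card_le hI.1 h]
  exact hI.2

lemma mm_rank_single {F : Type*} (M : Matroid F) (e : F) : matroidRank M {e} ≤ 1 := by
  unfold matroidRank
  apply Finset.sup_le
  intro I hI
  rw [Finset.mem_filter, Finset.mem_powerset] at hI
  simpa using Finset.card_le_card hI.1

/-- An integral point of the matroid polytope is an independent set. -/
lemma mm_extract {F : Type*} [Fintype F] (M : Matroid F) (u : F → ℕ)
    (hu : ∀ S : Finset F, ∑ e ∈ S, u e ≤ matroidRank M S) :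
    ∃ Fs : Finset F, M.Indep (Fs : Set F) ∧ ∀ e, u e = if e ∈ Fs then 1 else 0 := by
  have h1 : ∀ e, u e ≤ 1 := by
    intro e
    have := hu {e}
    rw [Finset.sum_singleton] at this
    exact this.trans (mm_rank_single M e)
  have h2 : ∀ e, u e = if e ∈ univ.filter (fun e => u e = 1) then 1 else 0 := by
    intro e
    have := h1 e
    simp only [Finset.mem_filter, Finset.mem_univ, true_and]
    split_ifs with h <;> omega
  refine ⟨univ.filter (fun e => u e = 1), ?_, h2⟩
  apply mm_indep
  refine le_trans (le_of_eq ?_) (hu _)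
  rw [Finset.card_eq_sum_ones]
  apply Finset.sum_congr rfl
  intro e he
  exact (Finset.mem_filter.1 he).2.symm

/-- Greedy selection. -/
lemma mm_greedy {K : Type*} (w : K → ℝ) (conf : K → K → Prop)
    (hsymm : ∀ j k, conf j k → conf k j) (s : Finset K) :
    ∃ J ⊆ s, (∀ j ∈ J, ∀ k ∈ J, j ≠ k → ¬ conf j k) ∧
      ∀ k ∈ s, k ∈ J ∨ ∃ j ∈ J, conf j k ∧ w j ≤ w k := by
  induction s using Finset.strongInduction with
  | H s ih =>
    rcases s.eq_empty_or_nonempty with rfl | hne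
    · exact ⟨∅, by simp, by simp, by simp⟩
    · obtain ⟨j, hj, hmin⟩ := Finset.exists_min_image s w hne
      obtain ⟨J, hJs, hJ1, hJ2⟩ := ih (s.filter (fun k => k ≠ j ∧ ¬ conf j k)) (by
        refine Finset.filter_ssubset.2 ⟨j, hj, by simp⟩)
      refine ⟨insert j J, ?_, ?_, ?_⟩
      · intro k hk
        rcases Finset.mem_insert.1 hk with rfl | hk
        · exact hj
        · exact (Finset.mem_filter.1 (hJs hk)).1
      · intro k hk l hl hkl
        rcases Finset.mem_insert.1 hk with rfl | hk2 <;>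
          rcases Finset.mem_insert.1 hl with rfl | hl2
        · exact absurd rfl hkl
        · exact (Finset.mem_filter.1 (hJs hl2)).2.2
        · exact fun hc => (Finset.mem_filter.1 (hJs hk2)).2.2 (hsymm _ _ hc)
        · exact hJ1 k hk2 l hl2 hkl
      · intro k hk
        by_cases hkj : k = j
        · left; rw [hkj]; exact Finset.mem_insert_self _ _
        by_cases hc : conf j k
        · right; exact ⟨j, Finset.mem_insert_self _ _, hc, hmin k hk⟩
        · rcases hJ2 k (Finset.mem_filter.2 ⟨hk, hkj, hc⟩) with h | ⟨l, hl, h⟩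
          · left; exact Finset.mem_insert_of_mem h
          · right; exact ⟨l, Finset.mem_insert_of_mem hl, h⟩

/-- The rounding for well-separated centers. -/
lemma mm_center {F K : Type*} [Fintype F] [Fintype K] [Nontrivial K]
    (M : Matroid F) (hME : M.E = Set.univ)
    (a : F → K → ℝ) (b : K → K → ℝ) (ha0 : ∀ i k, 0 ≤ a i k)
    (hbs : ∀ j k, b j k = b k j)
    (tri1 : ∀ i j k, a i k ≤ a i j + b j k)
    (tri2 : ∀ i j k, b j k ≤ a i j + a i k)
    (f : F → ℝ) (hf : ∀ i, 0 ≤ f i) (d : K → ℝ) (hd : ∀ k, 0 ≤ d k)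
    (x : F → K → ℝ) (y : F → ℝ) (hx : ∀ i k, 0 ≤ x i k) (hy : ∀ i, 0 ≤ y i)
    (hx1 : ∀ k, ∑ i, x i k = 1) (hxy : ∀ i k, x i k ≤ y i)
    (hrank : ∀ S : Finset F, ∑ i ∈ S, y i ≤ (matroidRank M S : ℝ))
    (C : K → ℝ) (hC : ∀ k, C k = ∑ i, a i k * x i k)
    (sep : ∀ j k, j ≠ k → 4 * C j < b j k) :
    ∃ (Fs : Finset F) (τ : K → F), M.Indep (Fs : Set F) ∧ (∀ k, τ k ∈ Fs) ∧
      ∑ i ∈ Fs, f i + ∑ k, d k * a (τ k) k ≤ ∑ i, f i * y i + 4 * ∑ k, d k * C k := by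
  have hσ : ∀ k : K, ∃ m, m ≠ k ∧ ∀ j, j ≠ k → b k m ≤ b k j := by
    intro k
    obtain ⟨m0, hm0⟩ := exists_ne k
    obtain ⟨m, hm, hmin⟩ := Finset.exists_min_image (univ.filter (fun j => j ≠ k)) (b k)
      ⟨m0, by simp [hm0]⟩
    simp only [Finset.mem_filter, Finset.mem_univ, true_and] at hm hmin
    exact ⟨m, hm, hmin⟩
  choose σ hσne hσmin using hσ
  set R : K → ℝ := fun k => b k (σ k) with hR
  have hC0 : ∀ k, 0 ≤ C k := fun k => by
    rw [hC]; exact Finset.sum_nonneg fun i _ => mul_nonneg (ha0 i k) (hx i k)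
  have hRC : ∀ k, 4 * C k < R k := fun k => sep k (σ k) (hσne k).symm
  have hRmin : ∀ j k, j ≠ k → R k ≤ b k j := fun j k h => hσmin k j h
  have hRσ : ∀ k, R (σ k) ≤ R k := fun k => by
    have := hRmin k (σ k) (hσne k).symm
    rw [hbs] at this; exact this
  set G : K → Finset F := fun k => univ.filter (fun i => 2 * a i k < R k) with hG
  set P : K → Finset F := fun k => univ.filter (fun i => a i k ≤ 2 * C k) with hP
  have hmG : ∀ i k, i ∈ G k ↔ 2 * a i k < R k := by intro i k; simp [hG]
  have hmP : ∀ i k, i ∈ P k ↔ a i k ≤ 2 * C k := by intro i k; simp [hP]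
  have hPG : ∀ k, P k ⊆ G k := by
    intro k i hi
    rw [hmP] at hi; rw [hmG]; linarith [hRC k]
  have huniq : ∀ i j k, i ∈ G j → i ∈ G k → j = k := by
    intro i j k hj hk
    by_contra hne
    rw [hmG] at hj hk
    have h1 := hRmin j k hne
    have h2 := hRmin k j (Ne.symm hne)
    rw [hbs] at h1
    have := tri2 i j k
    linarith
  have hdisj : ∀ j k, j ≠ k → Disjoint (G j) (G k) := by
    intro j k hne
    rw [Finset.disjoint_left]
    intro i hj hk
    exact hne (huniq i j k hj hk)
  -- the half-scaled point
  set v : F → ℝ := fun i => ∑ k, if i ∈ G k then 2 * x i k else 0 with hv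
  have hvin : ∀ i k, i ∈ G k → v i = 2 * x i k := by
    intro i k hi
    simp only [hv]
    rw [Finset.sum_eq_single k]
    · simp [hi]
    · intro j _ hj
      rw [if_neg]
      exact fun h => hj (huniq i j k h hi)
    · simp
  have hvle : ∀ i, v i ≤ 2 * y i := by
    intro i
    by_cases h : ∃ k, i ∈ G k
    · obtain ⟨k, hk⟩ := h
      rw [hvin i k hk]; linarith [hxy i k]
    · push Not at h
      simp only [hv]
      rw [Finset.sum_eq_zero (fun k _ => by rw [if_neg (h k)])]
      linarith [hy i]
  have hv0 : ∀ i, 0 ≤ v i := fun i => Finset.sum_nonneg fun k _ => by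
    split_ifs
    · linarith [hx i k]
    · exact le_refl _
  have hxP : ∀ k, 1 / 2 ≤ ∑ i ∈ P k, x i k := by
    intro k
    by_contra hcon
    push Not at hcon
    have h1 := Finset.sum_filter_add_sum_filter_not univ (fun i => a i k ≤ 2 * C k)
      (fun i => x i k)
    have h2 := Finset.sum_filter_add_sum_filter_not univ (fun i => a i k ≤ 2 * C k)
      (fun i => a i k * x i k)
    rw [hx1] at h1
    rw [← hC] at h2
    have h3 : 0 ≤ ∑ i ∈ univ.filter (fun i => a i k ≤ 2 * C k), a i k * x i k :=
      Finset.sum_nonneg fun i _ => mul_nonneg (ha0 i k) (hx i k)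
    have h4 : 1 / 2 < ∑ i ∈ univ.filter (fun i => ¬ a i k ≤ 2 * C k), x i k := by
      have : ∑ i ∈ univ.filter (fun i => a i k ≤ 2 * C k), x i k < 1 / 2 := hcon
      linarith
    obtain ⟨e, he, hex⟩ : ∃ e ∈ univ.filter (fun i => ¬ a i k ≤ 2 * C k), 0 < x e k := by
      by_contra hc
      have := Finset.sum_nonpos (s := univ.filter (fun i => ¬ a i k ≤ 2 * C k))
        (f := fun i => x i k) (fun e he => not_lt.1 (fun hlt => hc ⟨e, he, hlt⟩))
      linarith
    have h5 : ∑ i ∈ univ.filter (fun i => ¬ a i k ≤ 2 * C k), 2 * C k * x i k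
        < ∑ i ∈ univ.filter (fun i => ¬ a i k ≤ 2 * C k), a i k * x i k := by
      apply Finset.sum_lt_sum
      · intro i hi
        have := (Finset.mem_filter.1 hi).2
        exact mul_le_mul_of_nonneg_right (by linarith) (hx i k)
      · have := (Finset.mem_filter.1 he).2
        exact ⟨e, he, mul_lt_mul_of_pos_right (by linarith) hex⟩
    rw [← Finset.mul_sum] at h5
    nlinarith [hC0 k]
  have hvP : ∀ k, 1 ≤ ∑ i ∈ P k, v i := by
    intro k
    rw [Finset.sum_congr rfl (fun i hi => hvin i k (hPG k hi)), ← Finset.mul_sum]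
    linarith [hxP k]
  have hvG : ∀ k, ∑ i ∈ G k, v i ≤ 2 := by
    intro k
    rw [Finset.sum_congr rfl (fun i hi => hvin i k hi), ← Finset.mul_sum]
    have : ∑ i ∈ G k, x i k ≤ ∑ i, x i k :=
      Finset.sum_le_sum_of_subset_of_nonneg (Finset.subset_univ _) (fun i _ _ => hx i k)
    rw [hx1] at this
    linarith
  have hvρ : ∀ S : Finset F, ∑ i ∈ S, v i ≤ ((2 * matroidRank M S : ℕ) : ℝ) := by
    intro S
    calc ∑ i ∈ S, v i ≤ ∑ i ∈ S, 2 * y i := Finset.sum_le_sum fun i _ => hvle i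
      _ = 2 * ∑ i ∈ S, y i := by rw [Finset.mul_sum]
      _ ≤ 2 * (matroidRank M S : ℝ) := by linarith [hrank S]
      _ = _ := by push_cast; ring
  set w : F → ℝ := fun i => f i / 2 + ∑ k, if i ∈ G k then d k * (2 * a i k - R k) else 0 with hw
  have hwsum : ∀ z : F → ℝ, ∑ i, w i * z i = (∑ i, f i * z i) / 2
      + ∑ k, d k * ∑ i ∈ G k, (2 * a i k - R k) * z i := by
    intro z
    simp only [hw, add_mul, Finset.sum_add_distrib, Finset.sum_mul]
    rw [Finset.sum_comm]
    congr 1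
    · rw [Finset.sum_div]; exact Finset.sum_congr rfl fun i _ => by ring
    · apply Finset.sum_congr rfl
      intro k _
      rw [Finset.mul_sum]
      simp only [ite_mul, zero_mul]
      rw [← Finset.sum_filter]
      rw [Finset.filter_mem_eq_inter, Finset.univ_inter]
      exact Finset.sum_congr rfl fun i _ => by ring
  obtain ⟨u, huρ, huP, huG, huw⟩ := mm_round (fun S => 2 * matroidRank M S)
    (by simp [mm_rank_empty]) (fun S T => by have := mm_rank_sub M hME S T; omega)
    (univ : Finset K) P G 2 (fun k _ => hPG k) (fun j _ k _ h => hdisj j k h) w v hv0 hvρ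
    (fun k _ => hvP k) (fun k _ => by exact_mod_cast hvG k)
  simp only [Finset.mem_univ, true_implies] at huP huG
  rw [hwsum, hwsum] at huw
  -- bound of the LP value
  have hLP : (∑ i, f i * v i) / 2 + ∑ k, d k * (2 * R k + ∑ i ∈ G k, (2 * a i k - R k) * v i)
      ≤ ∑ i, f i * y i + 4 * ∑ k, d k * C k := by
    apply add_le_add
    · rw [Finset.sum_div]
      apply Finset.sum_le_sum
      intro i _
      have := mul_le_mul_of_nonneg_left (hvle i) (hf i)
      linarith
    · rw [Finset.mul_sum]
      apply Finset.sum_le_sum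
      intro k _
      have : 2 * R k + ∑ i ∈ G k, (2 * a i k - R k) * v i ≤ 4 * C k := by
        have e1 : ∑ i ∈ G k, (2 * a i k - R k) * v i
            = 4 * ∑ i ∈ G k, a i k * x i k - 2 * R k * ∑ i ∈ G k, x i k := by
          rw [Finset.mul_sum, Finset.mul_sum, ← Finset.sum_sub_distrib]
          exact Finset.sum_congr rfl fun i hi => by rw [hvin i k hi]; ring
        have h1 := Finset.sum_filter_add_sum_filter_not univ (fun i => 2 * a i k < R k)
          (fun i => x i k)
        have h2 := Finset.sum_filter_add_sum_filter_not univ (fun i => 2 * a i k < R k)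
          (fun i => a i k * x i k)
        rw [hx1] at h1
        rw [← hC] at h2
        have h3 : ∑ i ∈ univ.filter (fun i => ¬ 2 * a i k < R k), R k / 2 * x i k
            ≤ ∑ i ∈ univ.filter (fun i => ¬ 2 * a i k < R k), a i k * x i k := by
          apply Finset.sum_le_sum
          intro i hi
          have := (Finset.mem_filter.1 hi).2
          exact mul_le_mul_of_nonneg_right (by linarith) (hx i k)
        rw [← Finset.mul_sum] at h3
        have h1' : ∑ i ∈ univ.filter (fun i => ¬ 2 * a i k < R k), x i k
            = 1 - ∑ i ∈ G k, x i k := by rw [← h1]; simp [hG]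
        rw [h1'] at h3
        have h2' : ∑ i ∈ G k, a i k * x i k
          + ∑ i ∈ univ.filter (fun i => ¬ 2 * a i k < R k), a i k * x i k = C k := h2
        rw [e1]
        nlinarith
      nlinarith [hd k]
  -- primary facilities
  have hp : ∀ k, ∃ i ∈ P k, 1 ≤ u i := by
    intro k
    by_contra hcon
    push Not at hcon
    have := huP k
    rw [Finset.sum_eq_zero (fun i hi => by have := hcon i hi; omega)] at this
    omega
  choose p hpP hpu using hp
  have hpG : ∀ k, p k ∈ G k := fun k => hPG k (hpP k)
  have hpG' : ∀ j k, p j ∈ G k → j = k := fun j k h => huniq _ _ _ (hpG j) h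
  set c1 : K → ℝ := fun k => a (p k) k with hc1
  have hc10 : ∀ k, 0 ≤ c1 k := fun k => ha0 _ _
  have hc1R : ∀ k, 2 * c1 k ≤ R k := fun k => ((hmG _ _).1 (hpG k)).le
  have hG12 : ∀ k, ∑ i ∈ G k, u i ≠ 2 → ∑ i ∈ G k, u i = 1 := by
    intro k h
    have h1 := huG k
    have h2 : u (p k) ≤ ∑ i ∈ G k, u i := Finset.single_le_sum (fun _ _ => Nat.zero_le _) (hpG k)
    have := hpu k
    omega
  have hB1 : ∀ k, ∑ i ∈ G k, u i ≠ 2 → u (p k) = 1 ∧ ∀ i ∈ G k, i ≠ p k → u i = 0 := by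
    intro k h
    have h1 := hG12 k h
    rw [← Finset.add_sum_erase _ _ (hpG k)] at h1
    have := hpu k
    have h0 : ∑ i ∈ (G k).erase (p k), u i = 0 := by omega
    refine ⟨by omega, fun i hi hne => ?_⟩
    exact (Finset.sum_eq_zero_iff.1 h0) i (Finset.mem_erase.2 ⟨hne, hi⟩)
  -- greedy selection
  obtain ⟨J, hJs, hJ1, hJ2⟩ := mm_greedy (fun k => R k + c1 k + c1 (σ k))
    (fun j k => j = k ∨ j = σ k ∨ σ j = k ∨ σ j = σ k)
    (by
      intro j k h
      rcases h with h | h | h | h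
      · exact Or.inl h.symm
      · exact Or.inr (Or.inr (Or.inl h.symm))
      · exact Or.inr (Or.inl h.symm)
      · exact Or.inr (Or.inr (Or.inr h.symm)))
    (univ.filter (fun k => ∑ i ∈ G k, u i ≠ 2 ∧ ∑ i ∈ G (σ k), u i ≠ 2))
  have hJB : ∀ k ∈ J, ∑ i ∈ G k, u i ≠ 2 ∧ ∑ i ∈ G (σ k), u i ≠ 2 := fun k hk =>
    (Finset.mem_filter.1 (hJs hk)).2
  set S : K → Finset F := fun k => if ∑ i ∈ G k, u i = 2 then G k else {p k, p (σ k)} with hS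
  have hSA : ∀ k, ∑ i ∈ G k, u i = 2 → S k = G k := fun k h => by simp only [hS]; rw [if_pos h]
  have hSB : ∀ k, ∑ i ∈ G k, u i ≠ 2 → S k = {p k, p (σ k)} := fun k h => by
    simp only [hS]; rw [if_neg h]
  have hpinj : ∀ j k, p j = p k → j = k := fun j k h => hpG' j k (h ▸ hpG k)
  set s2 : Finset K := univ.filter (fun k => ∑ i ∈ G k, u i = 2 ∨ k ∈ J) with hs2
  have hSdisj : ∀ j ∈ s2, ∀ k ∈ s2, j ≠ k → Disjoint (S j) (S k) := by
    have hAJ : ∀ j k, ∑ i ∈ G j, u i = 2 → k ∈ J → Disjoint (S j) (S k) := by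
      intro j k hA hk
      rw [hSA j hA, hSB k (hJB k hk).1, Finset.disjoint_left]
      intro i hi hi2
      rw [Finset.mem_insert, Finset.mem_singleton] at hi2
      rcases hi2 with rfl | rfl
      · have := hpG' _ _ hi
        subst this; exact (hJB _ hk).1 hA
      · have := hpG' _ _ hi
        subst this; exact (hJB _ hk).2 hA
    intro j hj k hk hne
    rw [hs2, Finset.mem_filter] at hj hk
    by_cases hjA : ∑ i ∈ G j, u i = 2
    · by_cases hkA : ∑ i ∈ G k, u i = 2
      · rw [hSA j hjA, hSA k hkA]; exact hdisj j k hne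
      · exact hAJ j k hjA (hk.2.resolve_left hkA)
    · by_cases hkA : ∑ i ∈ G k, u i = 2
      · exact (hAJ k j hkA (hj.2.resolve_left hjA)).symm
      · have h1 := hJ1 j (hj.2.resolve_left hjA) k (hk.2.resolve_left hkA) hne
        rw [hSB j hjA, hSB k hkA, Finset.disjoint_left]
        intro i hi hi2
        rw [Finset.mem_insert, Finset.mem_singleton] at hi hi2
        apply h1
        rcases hi with rfl | rfl <;> rcases hi2 with h | h
        · exact Or.inl (hpinj _ _ h)
        · exact Or.inr (Or.inl (hpinj _ _ h))
        · exact Or.inr (Or.inr (Or.inl (hpinj _ _ h)))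
        · exact Or.inr (Or.inr (Or.inr (hpinj _ _ h)))
  have hSu : ∀ k ∈ s2, ∑ i ∈ S k, u i = 2 := by
    intro k hk
    rw [hs2, Finset.mem_filter] at hk
    by_cases hkA : ∑ i ∈ G k, u i = 2
    · rw [hSA k hkA, hkA]
    · have hkJ := hk.2.resolve_left hkA
      rw [hSB k hkA, Finset.sum_pair, (hB1 k hkA).1, (hB1 (σ k) (hJB k hkJ).2).1]
      intro h
      exact hσne k (hpinj _ _ h).symm
  set v2 : F → ℝ := fun i => (u i : ℝ) / 2 with hv2
  have hv2S : ∀ k ∈ s2, ∑ i ∈ S k, v2 i = 1 := by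
    intro k hk
    simp only [hv2]
    rw [← Finset.sum_div]
    have : ((∑ i ∈ S k, u i : ℕ) : ℝ) = 2 := by rw [hSu k hk]; norm_num
    push_cast at this
    rw [this]; norm_num
  set w2 : F → ℝ := fun i => f i + ∑ k, if ∑ i ∈ G k, u i = 2 then
      (if i ∈ G k then d k * a i k else 0)
      else (if i = p k then - (d k * (2 * R k + 2 * c1 k)) else 0) with hw2
  have hw2sum : ∀ z : F → ℝ, ∑ i, w2 i * z i = ∑ i, f i * z i
      + ∑ k, d k * (if ∑ i ∈ G k, u i = 2 then ∑ i ∈ G k, a i k * z i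
          else - ((2 * R k + 2 * c1 k) * z (p k))) := by
    intro z
    simp only [hw2, add_mul, Finset.sum_add_distrib, Finset.sum_mul]
    rw [Finset.sum_comm]
    congr 1
    apply Finset.sum_congr rfl
    intro k _
    split_ifs with hA
    · rw [Finset.mul_sum]
      simp only [ite_mul, zero_mul]
      rw [← Finset.sum_filter]
      rw [Finset.filter_mem_eq_inter, Finset.univ_inter]
      exact Finset.sum_congr rfl fun i _ => by ring
    · simp only [ite_mul, zero_mul]
      rw [Finset.sum_ite_eq' univ (p k)]
      simp only [Finset.mem_univ, if_true]
      ring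
  obtain ⟨z, hzρ, hzS, -, hzw⟩ := mm_round (fun S => matroidRank M S)
    (mm_rank_empty M) (fun S T => mm_rank_sub M hME S T)
    s2 S S 1 (fun k _ => Finset.Subset.refl _) hSdisj w2 v2 (fun i => by simp only [hv2]; positivity)
    (by
      intro T
      have := huρ T
      simp only [hv2]
      rw [← Finset.sum_div]
      have h2 : ((∑ i ∈ T, u i : ℕ) : ℝ) ≤ ((2 * matroidRank M T : ℕ) : ℝ) := by exact_mod_cast this
      push_cast at h2
      linarith)
    (fun k hk => (hv2S k hk).ge) (fun k hk => by rw [hv2S k hk]; norm_num)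
  rw [hw2sum, hw2sum] at hzw
  obtain ⟨Fs, hFs, hzFs⟩ := mm_extract M z hzρ
  have hopen : ∀ k ∈ s2, ∃ i ∈ S k, i ∈ Fs := by
    intro k hk
    by_contra hcon
    push Not at hcon
    have := hzS k hk
    rw [Finset.sum_eq_zero (fun i hi => by rw [hzFs, if_neg (hcon i hi)])] at this
    omega
  -- connection cost
  set H : K → (F → ℝ) → ℝ := fun k z => (if ∑ i ∈ G k, u i = 2 then ∑ i ∈ G k, a i k * z i
          else 2 * R k + 3 * c1 k - ((2 * R k + 2 * c1 k) * z (p k))) with hH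
  have hconn : ∀ k, ∃ i ∈ Fs, a i k ≤ H k (fun i => (z i : ℝ)) := by
    intro k
    by_cases hA : ∑ i ∈ G k, u i = 2
    · obtain ⟨i, hi, hiF⟩ := hopen k (by simp [hs2, hA])
      rw [hSA k hA] at hi
      refine ⟨i, hiF, ?_⟩
      simp only [hH, if_pos hA]
      have h1 : a i k * (z i : ℝ) ≤ ∑ i ∈ G k, a i k * (z i : ℝ) :=
        Finset.single_le_sum (f := fun i => a i k * (z i : ℝ))
          (fun i _ => mul_nonneg (ha0 i k) (Nat.cast_nonneg _)) hi
      rw [hzFs i, if_pos hiF] at h1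
      simpa using h1
    · simp only [hH, if_neg hA]
      by_cases hpk : p k ∈ Fs
      · refine ⟨p k, hpk, ?_⟩
        rw [hzFs, if_pos hpk]
        simp only [hc1]
        push_cast
        linarith
      · rw [hzFs, if_neg hpk]
        have hcR := hc1R k
        have hcR' := hc1R (σ k)
        have hR' := hRσ k
        have hck := hc10 k
        have hck' := hc10 (σ k)
        have hbk : b (σ k) k = R k := by rw [hbs]
        suffices hsuff : ∃ i ∈ Fs, a i k ≤ 2 * R k + 3 * c1 k by simpa using hsuff
        by_cases hA' : ∑ i ∈ G (σ k), u i = 2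
        · obtain ⟨i, hi, hiF⟩ := hopen (σ k) (by simp [hs2, hA'])
          rw [hSA _ hA', hmG] at hi
          refine ⟨i, hiF, ?_⟩
          have := tri1 i (σ k) k
          linarith
        · have hkin : k ∈ univ.filter
              (fun k => ∑ i ∈ G k, u i ≠ 2 ∧ ∑ i ∈ G (σ k), u i ≠ 2) := by simp [hA, hA']
          have hex : ∃ j ∈ J, (j = k ∨ j = σ k ∨ σ j = k ∨ σ j = σ k) ∧
              R j + c1 j + c1 (σ j) ≤ R k + c1 k + c1 (σ k) := by
            rcases hJ2 k hkin with h | h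
            · exact ⟨k, h, Or.inl rfl, le_refl _⟩
            · exact h
          obtain ⟨j, hj, hconf, hwj⟩ := hex
          obtain ⟨i, hi, hiF⟩ := hopen j (by simp [hs2, hj])
          rw [hSB j (hJB j hj).1, Finset.mem_insert, Finset.mem_singleton] at hi
          refine ⟨i, hiF, ?_⟩
          have hself : ∀ m, a (p m) m = c1 m := fun m => rfl
          have hRdef : ∀ m, b m (σ m) = R m := fun m => rfl
          have hpσ : a (p (σ k)) k ≤ 2 * R k + 3 * c1 k := by
            have := tri1 (p (σ k)) (σ k) k
            rw [hself, hbk] at this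
            linarith
          rcases hconf with rfl | rfl | h | h
          · rcases hi with rfl | rfl
            · exact absurd hiF hpk
            · exact hpσ
          · rcases hi with rfl | rfl
            · exact hpσ
            · have t1 := tri1 (p (σ (σ k))) (σ k) k
              have t2 := tri1 (p (σ (σ k))) (σ (σ k)) (σ k)
              rw [hself, hbs, hRdef] at t2
              rw [hbk] at t1
              linarith
          · subst h
            rcases hi with rfl | rfl
            · have t1 := tri1 (p j) j (σ j)
              rw [hself, hRdef] at t1
              linarith
            · exact absurd hiF hpk
          · rcases hi with rfl | rfl
            · have t1 := tri1 (p j) j (σ j)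
              rw [hself, hRdef] at t1
              rw [h] at t1 hwj
              have t2 := tri1 (p j) (σ k) k
              rw [hbk] at t2
              linarith
            · rw [h]; exact hpσ
  choose τ hτF hτ using hconn
  refine ⟨Fs, τ, hFs, hτF, ?_⟩
  have hHb : ∀ k, H k v2 ≤ 2 * R k + ∑ i ∈ G k, (2 * a i k - R k) * (u i : ℝ) := by
    intro k
    by_cases hA : ∑ i ∈ G k, u i = 2
    · simp only [hH, if_pos hA, hv2]
      have hA2 : ∑ i ∈ G k, (u i : ℝ) = 2 := by exact_mod_cast hA
      have e1 : ∑ i ∈ G k, (2 * a i k - R k) * (u i : ℝ)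
          = 2 * ∑ i ∈ G k, a i k * (u i : ℝ) - R k * ∑ i ∈ G k, (u i : ℝ) := by
        rw [Finset.mul_sum, Finset.mul_sum, ← Finset.sum_sub_distrib]
        exact Finset.sum_congr rfl fun i _ => by ring
      have e2 : ∑ i ∈ G k, a i k * ((u i : ℝ) / 2) = (∑ i ∈ G k, a i k * (u i : ℝ)) / 2 := by
        rw [Finset.sum_div]
        exact Finset.sum_congr rfl fun i _ => by ring
      have e3 : 0 ≤ ∑ i ∈ G k, a i k * (u i : ℝ) :=
        Finset.sum_nonneg fun i _ => mul_nonneg (ha0 i k) (Nat.cast_nonneg _)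
      rw [e1, e2, hA2]
      linarith
    · simp only [hH, if_neg hA, hv2]
      rw [Finset.sum_eq_single (p k)]
      · rw [(hB1 k hA).1]
        simp only [hc1]
        push_cast
        linarith
      · intro i hi hne
        rw [(hB1 k hA).2 i hi hne]; simp
      · intro h; exact absurd (hpG k) h
  have hHsplit : ∀ z : F → ℝ, ∑ k, d k * H k z
      = ∑ k, d k * (if ∑ i ∈ G k, u i = 2 then ∑ i ∈ G k, a i k * z i
          else - ((2 * R k + 2 * c1 k) * z (p k)))
        + ∑ k, d k * (if ∑ i ∈ G k, u i = 2 then 0 else 2 * R k + 3 * c1 k) := by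
    intro z
    rw [← Finset.sum_add_distrib]
    apply Finset.sum_congr rfl
    intro k _
    simp only [hH]
    split_ifs <;> ring
  have hfz : ∑ i ∈ Fs, f i = ∑ i, f i * (z i : ℝ) := by
    have : ∀ i, f i * (z i : ℝ) = if i ∈ Fs then f i else 0 := by
      intro i; rw [hzFs]; split_ifs <;> simp
    simp only [this]
    rw [← Finset.sum_filter, Finset.filter_mem_eq_inter, Finset.univ_inter]
  have hfv2 : ∑ i, f i * v2 i = (∑ i, f i * (u i : ℝ)) / 2 := by
    simp only [hv2]
    rw [Finset.sum_div]
    exact Finset.sum_congr rfl fun i _ => by ring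
  have g1 : ∑ k, d k * a (τ k) k ≤ ∑ k, d k * H k (fun i => (z i : ℝ)) :=
    Finset.sum_le_sum fun k _ => mul_le_mul_of_nonneg_left (hτ k) (hd k)
  have g2 : ∑ k, d k * H k v2
      ≤ ∑ k, d k * (2 * R k + ∑ i ∈ G k, (2 * a i k - R k) * (u i : ℝ)) :=
    Finset.sum_le_sum fun k _ => mul_le_mul_of_nonneg_left (hHb k) (hd k)
  have g3 : ∀ z : F → ℝ, ∑ k, d k * (2 * R k + ∑ i ∈ G k, (2 * a i k - R k) * z i)
      = ∑ k, d k * (2 * R k) + ∑ k, d k * ∑ i ∈ G k, (2 * a i k - R k) * z i := by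
    intro z
    rw [← Finset.sum_add_distrib]
    exact Finset.sum_congr rfl fun k _ => by ring
  rw [g3] at g2 hLP
  rw [hHsplit] at g1 g2
  rw [hfz]
  linarith

lemma mm_center_all {F K : Type*} [Fintype F] [Fintype K]
    (M : Matroid F) (hME : M.E = Set.univ)
    (a : F → K → ℝ) (b : K → K → ℝ) (ha0 : ∀ i k, 0 ≤ a i k)
    (hbs : ∀ j k, b j k = b k j)
    (tri1 : ∀ i j k, a i k ≤ a i j + b j k)
    (tri2 : ∀ i j k, b j k ≤ a i j + a i k)
    (f : F → ℝ) (hf : ∀ i, 0 ≤ f i) (d : K → ℝ) (hd : ∀ k, 0 ≤ d k)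
    (x : F → K → ℝ) (y : F → ℝ) (hx : ∀ i k, 0 ≤ x i k) (hy : ∀ i, 0 ≤ y i)
    (hx1 : ∀ k, ∑ i, x i k = 1) (hxy : ∀ i k, x i k ≤ y i)
    (hrank : ∀ S : Finset F, ∑ i ∈ S, y i ≤ (matroidRank M S : ℝ))
    (C : K → ℝ) (hC : ∀ k, C k = ∑ i, a i k * x i k)
    (sep : ∀ j k, j ≠ k → 4 * C j < b j k) :
    ∃ (Fs : Finset F) (τ : K → F), M.Indep (Fs : Set F) ∧ (∀ k, τ k ∈ Fs) ∧
      ∑ i ∈ Fs, f i + ∑ k, d k * a (τ k) k ≤ ∑ i, f i * y i + 4 * ∑ k, d k * C k := by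
  rcases subsingleton_or_nontrivial K with hK | hK
  · rcases isEmpty_or_nonempty K with hE | ⟨⟨k⟩⟩
    · refine ⟨∅, isEmptyElim, by simp, isEmptyElim, ?_⟩
      simp only [Finset.sum_empty, Finset.univ_eq_empty]
      have : 0 ≤ ∑ i, f i * y i := Finset.sum_nonneg fun i _ => mul_nonneg (hf i) (hy i)
      linarith
    · obtain ⟨u, hu, huP, huG, huw⟩ := mm_round (fun S => matroidRank M S)
        (mm_rank_empty M) (fun S T => mm_rank_sub M hME S T)
        ({k} : Finset K) (fun _ => univ) (fun _ => univ) 1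
        (fun k _ => Finset.Subset.refl _)
        (fun j _ l _ h => absurd (Subsingleton.elim j l) h)
        (fun i => f i + d k * a i k) (fun i => x i k) (fun i => hx i k)
        (fun S => (Finset.sum_le_sum fun i _ => hxy i k).trans (hrank S))
        (fun j _ => (hx1 k).ge) (fun j _ => by simpa using (hx1 k).le)
      obtain ⟨Fs, hFs, huF⟩ := mm_extract M u hu
      have h1 := huP k (by simp)
      obtain ⟨e, he⟩ : ∃ e, e ∈ Fs := by
        by_contra hc
        have h0 : ∀ e, u e = 0 := fun e => by
          rw [huF e, if_neg (fun h => hc ⟨e, h⟩)]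
        simp [h0] at h1
      refine ⟨Fs, fun _ => e, hFs, fun _ => he, ?_⟩
      have hU : ∀ g : K → ℝ, ∑ l, g l = g k := fun g => by
        rw [Finset.sum_eq_single k]
        · intro l _ hl
          exact absurd (Subsingleton.elim l k) hl
        · simp
      rw [hU, hU]
      have h2 : ∑ i, (f i + d k * a i k) * (u i : ℝ) = ∑ i ∈ Fs, (f i + d k * a i k) := by
        simp [huF]
      have h3 : d k * a e k ≤ ∑ i ∈ Fs, d k * a i k :=
        Finset.single_le_sum (f := fun i => d k * a i k)
          (fun i _ => mul_nonneg (hd k) (ha0 i k)) he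
      have h4 : ∑ i, (f i + d k * a i k) * x i k = ∑ i, f i * x i k + d k * C k := by
        rw [hC, Finset.mul_sum, ← Finset.sum_add_distrib]
        exact Finset.sum_congr rfl fun i _ => by ring
      have h5 : ∑ i, f i * x i k ≤ ∑ i, f i * y i :=
        Finset.sum_le_sum fun i _ => mul_le_mul_of_nonneg_left (hxy i k) (hf i)
      have h6 : 0 ≤ d k * C k := by
        rw [hC]
        exact mul_nonneg (hd k) (Finset.sum_nonneg fun i _ => mul_nonneg (ha0 i k) (hx i k))
      rw [h2, h4, Finset.sum_add_distrib] at huw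
      linarith
  · exact mm_center M hME a b ha0 hbs tri1 tri2 f hf d hd x y hx hy hx1 hxy hrank C hC sep


/-- Remark 3.6: the Lagrangian-multiplier-preserving 8-approximation guarantee
for matroid median. -/
theorem matroid_median_LMP_8
    {F D : Type*} [Fintype F] [Fintype D]
    (c : F ⊕ D → F ⊕ D → ℝ)
    (hc_nonneg : ∀ u v, 0 ≤ c u v)
    (hc_symm : ∀ u v, c u v = c v u)
    (hc_tri : ∀ u v w, c u w ≤ c u v + c v w)
    (f : F → ℝ) (hf : ∀ i, 0 ≤ f i)
    (d : D → ℝ) (hd : ∀ j, 0 ≤ d j)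
    (M : Matroid F) (hME : M.E = Set.univ)
    (x : F → D → ℝ) (y : F → ℝ)
    (hx : ∀ i j, 0 ≤ x i j) (hy : ∀ i, 0 ≤ y i)
    (hx1 : ∀ j, 1 ≤ ∑ i, x i j)
    (hxy : ∀ i j, x i j ≤ y i)
    (hrank : ∀ S : Finset F, ∑ i ∈ S, y i ≤ (matroidRank M S : ℝ)) :
    ∃ (Fs : Finset F) (σ : D → F),
      M.Indep ↑Fs ∧ (∀ j, σ j ∈ Fs) ∧
      8 * (∑ i ∈ Fs, f i) + ∑ j, d j * c (Sum.inl (σ j)) (Sum.inr j) ≤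
        8 * ((∑ i, f i * y i) + ∑ j, ∑ i, d j * c (Sum.inl i) (Sum.inr j) * x i j) := by
  set X : D → ℝ := fun j => ∑ i, x i j with hX
  have hXpos : ∀ j, 0 < X j := fun j => lt_of_lt_of_le one_pos (hx1 j)
  set z : F → D → ℝ := fun i j => x i j / X j with hz
  have hz0 : ∀ i j, 0 ≤ z i j := fun i j => div_nonneg (hx i j) (hXpos j).le
  have hzx : ∀ i j, z i j ≤ x i j := fun i j => div_le_self (hx i j) (hx1 j)
  have hz1 : ∀ j, ∑ i, z i j = 1 := fun j => by
    simp only [hz]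
    rw [← Finset.sum_div]
    exact div_self (hXpos j).ne'
  set C : D → ℝ := fun j => ∑ i, c (Sum.inl i) (Sum.inr j) * z i j with hC
  have hC0 : ∀ j, 0 ≤ C j := fun j =>
    Finset.sum_nonneg fun i _ => mul_nonneg (hc_nonneg _ _) (hz0 i j)
  obtain ⟨J, -, hJ1, hJ2⟩ := mm_greedy C
    (fun j k => c (Sum.inr j) (Sum.inr k) ≤ 4 * max (C j) (C k))
    (by
      intro j k h
      rw [hc_symm, max_comm]
      exact h) (univ : Finset D)
  have hκ : ∀ j : D, ∃ k : {k // k ∈ J}, C k ≤ C j ∧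
      ∀ i, c (Sum.inl i) (Sum.inr j) ≤ c (Sum.inl i) (Sum.inr k.1) + 4 * C j := by
    intro j
    rcases hJ2 j (Finset.mem_univ j) with hj | ⟨k, hk, h1, h2⟩
    · refine ⟨⟨j, hj⟩, le_refl _, fun i => ?_⟩
      have := hC0 j
      simp only
      linarith
    · refine ⟨⟨k, hk⟩, h2, fun i => ?_⟩
      rw [max_eq_right h2] at h1
      have := hc_tri (Sum.inl i) (Sum.inr k) (Sum.inr j)
      simp only
      linarith
  choose κ hκ1 hκ2 using hκ
  have hfib : ∀ g : {k // k ∈ J} → ℝ,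
      ∑ k, (∑ j ∈ univ.filter (fun j => κ j = k), d j) * g k = ∑ j, d j * g (κ j) := by
    intro g
    rw [← Finset.sum_fiberwise (univ : Finset D) κ (fun j => d j * g (κ j))]
    refine Finset.sum_congr rfl fun k _ => ?_
    rw [Finset.sum_mul]
    refine Finset.sum_congr rfl fun j hj => ?_
    rw [(Finset.mem_filter.1 hj).2]
  obtain ⟨Fs, τ, hFs, hτ, hcost⟩ := mm_center_all (K := {k // k ∈ J}) M hME
    (fun i k => c (Sum.inl i) (Sum.inr k.1)) (fun j k => c (Sum.inr j.1) (Sum.inr k.1))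
    (fun i k => hc_nonneg _ _) (fun j k => hc_symm _ _)
    (fun i j k => hc_tri _ _ _)
    (fun i j k => by
      have := hc_tri (Sum.inr j.1) (Sum.inl i) (Sum.inr k.1)
      rw [hc_symm (Sum.inr j.1) (Sum.inl i)] at this
      exact this)
    (fun i => 8 * f i) (fun i => mul_nonneg (by norm_num) (hf i))
    (fun k => ∑ j ∈ univ.filter (fun j => κ j = k), d j)
    (fun k => Finset.sum_nonneg fun j _ => hd j)
    (fun i k => z i k.1) y (fun i k => hz0 _ _) hy (fun k => hz1 _)
    (fun i k => (hzx _ _).trans (hxy _ _)) hrank (fun k => C k.1) (fun k => rfl)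
    (fun j k hjk => by
      have h := hJ1 j.1 j.2 k.1 k.2 (fun h => hjk (Subtype.ext h))
      have h2 := le_max_left (C j.1) (C k.1)
      have h3 := not_le.1 h
      linarith)
  refine ⟨Fs, fun j => τ (κ j), hFs, fun j => hτ _, ?_⟩
  rw [hfib (fun k => c (Sum.inl (τ k)) (Sum.inr k.1)), hfib (fun k => C k.1),
    ← Finset.mul_sum] at hcost
  have e1 : ∑ i, 8 * f i * y i = 8 * ∑ i, f i * y i := by
    rw [Finset.mul_sum]
    exact Finset.sum_congr rfl fun i _ => by ring
  rw [e1] at hcost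
  have e2 : ∑ j, d j * c (Sum.inl (τ (κ j))) (Sum.inr j)
      ≤ ∑ j, d j * c (Sum.inl (τ (κ j))) (Sum.inr (κ j).1) + 4 * ∑ j, d j * C j := by
    rw [Finset.mul_sum, ← Finset.sum_add_distrib]
    refine Finset.sum_le_sum fun j _ => ?_
    have := mul_le_mul_of_nonneg_left (hκ2 j (τ (κ j))) (hd j)
    linarith
  have e3 : ∑ j, d j * C (κ j).1 ≤ ∑ j, d j * C j :=
    Finset.sum_le_sum fun j _ => mul_le_mul_of_nonneg_left (hκ1 j) (hd j)
  have e4 : ∑ j, d j * C j ≤ ∑ j, ∑ i, d j * c (Sum.inl i) (Sum.inr j) * x i j := by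
    refine Finset.sum_le_sum fun j _ => ?_
    simp only [hC]
    rw [Finset.mul_sum]
    refine Finset.sum_le_sum fun i _ => ?_
    rw [← mul_assoc]
    exact mul_le_mul_of_nonneg_left (hzx i j) (mul_nonneg (hd j) (hc_nonneg _ _))
  linarith
end
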